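/- Let Ω be a finite set with |Ω| = m, let P be an ℓ-step probability distribution on Ω^ℓ whose j-th marginal π^{(j)} has support all of Ω for each j, and assume ρ(P) < 1. Then for all μ^{(1)},…,μ^{(ℓ)} ∈ (0,1] there exist k ∈ ℕ, γ > 0 and δ > 0 (depending only on P and μ^{(1)},…,μ^{(ℓ)}) such that: for every n ≥ 1, for every choice, for each j ∈ [ℓ], of a Fourier basis φ^{(j)}₀ ≡ 1, φ^{(j)}₁, …, φ^{(j)}_{m−1} for (Ω, π^{(j)}), and for all functions f^{(1)},…,f^{(ℓ)} : Ωⁿ → [0,1] satisfying E[f^{(j)}(X^{(j)})] = μ^{(j)} and |f̂^{(j)}(σ)| ≤ γ for every σ ∈ {0,…,m−1}ⁿ with 0 < |σ| ≤ k, one has E[∏_{j=1}^ℓ f^{(j)}(X^{(j)})] ≥ δ. -/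

import Mathlib

namespace SameSetHitting

/-- `P` is a probability distribution on a finite type. -/
def IsDist {α : Type} [Fintype α] (P : α → ℝ) : Prop :=
  (∀ x, 0 ≤ P x) ∧ ∑ x, P x = 1

open Classical in
/-- The `j`-th marginal of an `ℓ`-step distribution `P`. -/
noncomputable def marginal {Ω : Type} [Fintype Ω] {ℓ : ℕ}
    (P : (Fin ℓ → Ω) → ℝ) (j : Fin ℓ) (a : Ω) : ℝ :=
  ∑ x : Fin ℓ → Ω, if x j = a then P x else 0

/-- All `ℓ` marginals of `P` are equal to `π`. -/
def HasMarginals {Ω : Type} [Fintype Ω] {ℓ : ℕ}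
    (P : (Fin ℓ → Ω) → ℝ) (π : Ω → ℝ) : Prop :=
  ∀ j a, marginal P j a = π a

/-- The expectation `E[f(X)]` where `X` has the product law `πⁿ`. -/
noncomputable def exps {Ω : Type} [Fintype Ω] {n : ℕ}
    (π : Ω → ℝ) (f : (Fin n → Ω) → ℝ) : ℝ :=
  ∑ v : Fin n → Ω, (∏ i, π (v i)) * f v

/-- `E[∏_{j} f_j(X^{(j)})]` where the tuples `(X_i^{(1)}, …, X_i^{(ℓ)})`,
`i = 1, …, n`, are i.i.d. with law `P` and `X^{(j)} = (X_1^{(j)}, …, X_n^{(j)})`. -/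
noncomputable def prodExp {Ω : Type} [Fintype Ω] {ℓ n : ℕ}
    (P : (Fin ℓ → Ω) → ℝ) (f : Fin ℓ → ((Fin n → Ω) → ℝ)) : ℝ :=
  ∑ x : Fin ℓ → Fin n → Ω, (∏ i, P (fun j => x j i)) * ∏ j, f j (x j)

/-- Expectation under the single-coordinate multi-step distribution `P`. -/
noncomputable def expP {Ω : Type} [Fintype Ω] {ℓ : ℕ}
    (P : (Fin ℓ → Ω) → ℝ) (f : (Fin ℓ → Ω) → ℝ) : ℝ :=
  ∑ x, P x * f x

/-- Covariance under `P`. -/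
noncomputable def covP {Ω : Type} [Fintype Ω] {ℓ : ℕ}
    (P : (Fin ℓ → Ω) → ℝ) (f g : (Fin ℓ → Ω) → ℝ) : ℝ :=
  expP P (fun x => f x * g x) - expP P f * expP P g

/-- Variance under `P`. -/
noncomputable def varP {Ω : Type} [Fintype Ω] {ℓ : ℕ}
    (P : (Fin ℓ → Ω) → ℝ) (f : (Fin ℓ → Ω) → ℝ) : ℝ :=
  covP P f f

/-- `f` depends only on the coordinates in `S`. -/
def DependsOn {Ω : Type} {ℓ : ℕ} (f : (Fin ℓ → Ω) → ℝ) (S : Finset (Fin ℓ)) : Prop :=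
  ∀ x y : Fin ℓ → Ω, (∀ j ∈ S, x j = y j) → f x = f y

/-- The correlation `ρ(P, S, T)`. -/
noncomputable def rhoST {Ω : Type} [Fintype Ω] {ℓ : ℕ}
    (P : (Fin ℓ → Ω) → ℝ) (S T : Finset (Fin ℓ)) : ℝ :=
  sSup {r : ℝ | ∃ f g : (Fin ℓ → Ω) → ℝ, DependsOn f S ∧ DependsOn g T ∧
    varP P f = 1 ∧ varP P g = 1 ∧ r = covP P f g}

/-- The correlation `ρ(P) = max_j ρ(P, {j}, [ℓ]∖{j})`. -/
noncomputable def rho {Ω : Type} [Fintype Ω] {ℓ : ℕ} (P : (Fin ℓ → Ω) → ℝ) : ℝ :=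
  ⨆ j : Fin ℓ, rhoST P {j} ({j}ᶜ)

/-- Expectation under the single-step distribution `π`. -/
noncomputable def expPi {Ω : Type} [Fintype Ω] (π : Ω → ℝ) (f : Ω → ℝ) : ℝ :=
  ∑ a, π a * f a

/-- Variance under the single-step distribution `π`. -/
noncomputable def varPi {Ω : Type} [Fintype Ω] (π : Ω → ℝ) (f : Ω → ℝ) : ℝ :=
  expPi π (fun a => (f a - expPi π f) ^ 2)

/-- The influence `Inf_i(f(X))` of coordinate `i`, where `X` has product law `πⁿ`. -/
noncomputable def influence {Ω : Type} [Fintype Ω] {n : ℕ}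
    (π : Ω → ℝ) (i : Fin n) (f : (Fin n → Ω) → ℝ) : ℝ :=
  ∑ v : Fin n → Ω, (∏ k, π (v k)) * varPi π (fun a => f (Function.update v i a))

/-- The function obtained from `f` by applying the restriction `R`
(`none` means unrestricted). -/
def restrict {Ω : Type} {n : ℕ} (R : Fin n → Option Ω)
    (f : (Fin n → Ω) → ℝ) : (Fin n → Ω) → ℝ :=
  fun x => f (fun i => (R i).getD (x i))

/-- The size (number of restricted coordinates) of a restriction. -/
def restSize {Ω : Type} {n : ℕ} (R : Fin n → Option Ω) : ℕ :=
  (Finset.univ.filter (fun i => (R i).isSome = true)).card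

/-- `f` is `ε`-resilient up to size `k` (with respect to the product law `πⁿ`). -/
def Resilient {Ω : Type} [Fintype Ω] {n : ℕ} (π : Ω → ℝ) (ε : ℝ) (k : ℕ)
    (f : (Fin n → Ω) → ℝ) : Prop :=
  ∀ R : Fin n → Option Ω, restSize R ≤ k →
    (1 - ε) * exps π f ≤ exps π (restrict R f) ∧
    exps π (restrict R f) ≤ (1 + ε) * exps π f

/-- The restriction operator `R[i,a]`. -/
def restrOp {Ω : Type} {n : ℕ} (i : Fin n) (a : Ω)
    (f : (Fin n → Ω) → ℝ) : (Fin n → Ω) → ℝ :=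
  fun x => f (Function.update x i a)

/-- The maximum operator `M[i,y,z]`. -/
def maxOp {Ω : Type} {n : ℕ} (i : Fin n) (y z : Ω)
    (f : (Fin n → Ω) → ℝ) : (Fin n → Ω) → ℝ :=
  fun x => max (f (Function.update x i y)) (f (Function.update x i z))

/-- Insert the value `a` at position `j` into `w : Ω^{[ℓ] ∖ {j}}`. -/
def ins {Ω : Type} {ℓ : ℕ} (j : Fin ℓ) (w : {k : Fin ℓ // k ≠ j} → Ω) (a : Ω) :
    Fin ℓ → Ω :=
  fun k => if h : k = j then a else w ⟨k, h⟩

/-- The probability that the coordinates other than `j` equal `w`. -/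
noncomputable def margOff {Ω : Type} [Fintype Ω] {ℓ : ℕ}
    (P : (Fin ℓ → Ω) → ℝ) (j : Fin ℓ) (w : {k : Fin ℓ // k ≠ j} → Ω) : ℝ :=
  ∑ a, P (ins j w a)

open Classical in
/-- The joint law of `(Y, Z)` for a double sample on step `j` from `P`. -/
noncomputable def doubleSample {Ω : Type} [Fintype Ω] {ℓ : ℕ}
    (P : (Fin ℓ → Ω) → ℝ) (j : Fin ℓ) (y z : Ω) : ℝ :=
  ∑ w : {k : Fin ℓ // k ≠ j} → Ω,
    if margOff P j w = 0 then 0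
    else P (ins j w y) * P (ins j w z) / margOff P j w



/-! ### Basic facts on product expectations -/

lemma exps_insertNth {Ω : Type} [Fintype Ω] {n : ℕ} (p : Ω → ℝ) (i : Fin (n+1))
    (f : (Fin (n+1) → Ω) → ℝ) :
    exps p f = ∑ a, p a * exps p (fun v : Fin n → Ω => f (i.insertNth a v)) := by
  unfold exps
  rw [← (Fin.insertNthEquiv (fun _ => Ω) i).sum_comp, Fintype.sum_prod_type]
  refine Finset.sum_congr rfl fun a _ => ?_
  rw [Finset.mul_sum]
  refine Finset.sum_congr rfl fun v _ => ?_
  rw [Fin.prod_univ_succAbove _ i]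
  simp [Fin.insertNthEquiv, mul_assoc]

lemma exps_succ {Ω : Type} [Fintype Ω] {n : ℕ} (p : Ω → ℝ)
    (f : (Fin (n+1) → Ω) → ℝ) :
    exps p f = ∑ a, p a * exps p (fun v : Fin n → Ω => f (Fin.cons a v)) := by
  rw [exps_insertNth p 0]
  simp only [Fin.insertNth_zero']

lemma exps_zero {Ω : Type} [Fintype Ω] (p : Ω → ℝ)
    (f : (Fin 0 → Ω) → ℝ) : exps p f = f Fin.elim0 := by
  unfold exps
  rw [Fintype.sum_unique]
  simp only [Finset.univ_eq_empty, Finset.prod_empty, one_mul]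
  congr 1

lemma exps_add {Ω : Type} [Fintype Ω] {n : ℕ} (p : Ω → ℝ) (f g : (Fin n → Ω) → ℝ) :
    exps p (fun v => f v + g v) = exps p f + exps p g := by
  simp only [exps, mul_add, Finset.sum_add_distrib]

lemma exps_sub {Ω : Type} [Fintype Ω] {n : ℕ} (p : Ω → ℝ) (f g : (Fin n → Ω) → ℝ) :
    exps p (fun v => f v - g v) = exps p f - exps p g := by
  simp only [exps, mul_sub, Finset.sum_sub_distrib]

lemma exps_mul_left {Ω : Type} [Fintype Ω] {n : ℕ} (p : Ω → ℝ) (c : ℝ)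
    (f : (Fin n → Ω) → ℝ) : exps p (fun v => c * f v) = c * exps p f := by
  simp only [exps, Finset.mul_sum]
  exact Finset.sum_congr rfl fun v _ => by ring

lemma exps_mul_right {Ω : Type} [Fintype Ω] {n : ℕ} (p : Ω → ℝ) (c : ℝ)
    (f : (Fin n → Ω) → ℝ) : exps p (fun v => f v * c) = exps p f * c := by
  simp only [exps, Finset.sum_mul]
  exact Finset.sum_congr rfl fun v _ => by ring

lemma exps_sum {Ω ι : Type} [Fintype Ω] {n : ℕ} (p : Ω → ℝ) (s : Finset ι)
    (f : ι → (Fin n → Ω) → ℝ) :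
    exps p (fun v => ∑ k ∈ s, f k v) = ∑ k ∈ s, exps p (f k) := by
  simp only [exps, Finset.mul_sum]
  exact Finset.sum_comm

lemma exps_swap {Ω W : Type} [Fintype Ω] [Fintype W] {n k : ℕ} (p : Ω → ℝ) (q : W → ℝ)
    (f : (Fin n → Ω) → (Fin k → W) → ℝ) :
    exps p (fun v => exps q (fun w => f v w)) = exps q (fun w => exps p (fun v => f v w)) := by
  simp only [exps, Finset.mul_sum]
  rw [Finset.sum_comm]
  exact Finset.sum_congr rfl fun v _ => Finset.sum_congr rfl fun w _ => by ring

lemma exps_mono {Ω : Type} [Fintype Ω] {n : ℕ} {p : Ω → ℝ} (hp : ∀ a, 0 ≤ p a)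
    {f g : (Fin n → Ω) → ℝ} (h : ∀ v, f v ≤ g v) : exps p f ≤ exps p g := by
  unfold exps
  exact Finset.sum_le_sum fun v _ =>
    mul_le_mul_of_nonneg_left (h v) (Finset.prod_nonneg fun i _ => hp _)

lemma exps_nonneg {Ω : Type} [Fintype Ω] {n : ℕ} {p : Ω → ℝ} (hp : ∀ a, 0 ≤ p a)
    {f : (Fin n → Ω) → ℝ} (h : ∀ v, 0 ≤ f v) : 0 ≤ exps p f := by
  unfold exps
  exact Finset.sum_nonneg fun v _ => mul_nonneg (Finset.prod_nonneg fun i _ => hp _) (h v)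

lemma exps_const {Ω : Type} [Fintype Ω] {n : ℕ} {p : Ω → ℝ} (hp : ∑ a, p a = 1) (c : ℝ) :
    exps p (fun _ : Fin n → Ω => c) = c := by
  induction n with
  | zero => rw [exps_zero]
  | succ n ih => rw [exps_succ]; simp only [ih]; rw [← Finset.sum_mul, hp, one_mul]

lemma exps_update {Ω : Type} [Fintype Ω] {n : ℕ} {p : Ω → ℝ} (hp : ∑ a, p a = 1) (i : Fin n)
    (f : (Fin n → Ω) → ℝ) :
    exps p (fun v => ∑ a, p a * f (Function.update v i a)) = exps p f := by
  cases n with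
  | zero => exact i.elim0
  | succ n =>
    rw [exps_insertNth p i, exps_insertNth p i f]
    simp only [Fin.update_insertNth]
    rw [← Finset.sum_mul, hp, one_mul, exps_sum]
    exact Finset.sum_congr rfl fun a _ => exps_mul_left _ _ _

/-- Cauchy-Schwarz for product expectations. -/
lemma exps_cs {Ω : Type} [Fintype Ω] {n : ℕ} {p : Ω → ℝ} (hp : ∀ a, 0 ≤ p a)
    (f g : (Fin n → Ω) → ℝ) :
    (exps p (fun v => f v * g v)) ^ 2 ≤
      exps p (fun v => f v ^ 2) * exps p (fun v => g v ^ 2) := by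
  unfold exps
  refine Finset.sum_sq_le_sum_mul_sum_of_sq_le_mul _ ?_ ?_ ?_
  · exact fun v _ => mul_nonneg (Finset.prod_nonneg fun i _ => hp _) (sq_nonneg _)
  · exact fun v _ => mul_nonneg (Finset.prod_nonneg fun i _ => hp _) (sq_nonneg _)
  · intro v _; exact le_of_eq (by ring)

/-- The tensor power of a kernel. -/
noncomputable def Kn {Ω W : Type} [Fintype Ω] {n : ℕ} (K : W → Ω → ℝ)
    (g : (Fin n → Ω) → ℝ) (w : Fin n → W) : ℝ :=
  ∑ v : Fin n → Ω, (∏ i, K (w i) (v i)) * g v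

lemma Kn_succ {Ω W : Type} [Fintype Ω] {n : ℕ} (K : W → Ω → ℝ)
    (g : (Fin (n+1) → Ω) → ℝ) (w : W) (ws : Fin n → W) :
    Kn K g (Fin.cons w ws) = ∑ a, K w a * Kn K (fun v => g (Fin.cons a v)) ws := by
  unfold Kn
  rw [← (Fin.consEquiv (fun _ => Ω)).sum_comp, Fintype.sum_prod_type]
  refine Finset.sum_congr rfl fun a _ => ?_
  rw [Finset.mul_sum]
  refine Finset.sum_congr rfl fun v _ => ?_
  rw [Fin.prod_univ_succ]
  simp [Fin.consEquiv, mul_assoc]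

lemma Kn_sum {Ω W ι : Type} [Fintype Ω] {n : ℕ} (K : W → Ω → ℝ) (s : Finset ι)
    (c : ι → ℝ) (g : ι → (Fin n → Ω) → ℝ) (w : Fin n → W) :
    Kn K (fun v => ∑ k ∈ s, c k * g k v) w = ∑ k ∈ s, c k * Kn K (g k) w := by
  unfold Kn
  simp only [Finset.mul_sum]
  rw [Finset.sum_comm]
  exact Finset.sum_congr rfl fun v _ => Finset.sum_congr rfl fun w _ => by ring

lemma Kn_succ' {Ω W : Type} [Fintype Ω] {n : ℕ} (K : W → Ω → ℝ)
    (g : (Fin (n+1) → Ω) → ℝ) (w : W) (ws : Fin n → W) :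
    Kn K g (Fin.cons w ws) = Kn K (fun v => ∑ a, K w a * g (Fin.cons a v)) ws := by
  rw [Kn_succ, Kn_sum]

lemma Kn_zero {Ω W : Type} [Fintype Ω] (K : W → Ω → ℝ)
    (g : (Fin 0 → Ω) → ℝ) (w : Fin 0 → W) : Kn K g w = g Fin.elim0 := by
  unfold Kn
  rw [Fintype.sum_unique]
  simp only [Finset.univ_eq_empty, Finset.prod_empty, one_mul]
  congr 1

lemma Kn_sub {Ω W : Type} [Fintype Ω] {n : ℕ} (K : W → Ω → ℝ)
    (f g : (Fin n → Ω) → ℝ) (w : Fin n → W) :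
    Kn K (fun v => f v - g v) w = Kn K f w - Kn K g w := by
  simp only [Kn, mul_sub, Finset.sum_sub_distrib]

lemma Kn_mono {Ω W : Type} [Fintype Ω] {n : ℕ} {K : W → Ω → ℝ} (hK : ∀ w a, 0 ≤ K w a)
    {f g : (Fin n → Ω) → ℝ} (h : ∀ v, f v ≤ g v) (w : Fin n → W) : Kn K f w ≤ Kn K g w := by
  unfold Kn
  exact Finset.sum_le_sum fun v _ =>
    mul_le_mul_of_nonneg_left (h v) (Finset.prod_nonneg fun i _ => hK _ _)

lemma Kn_const {Ω W : Type} [Fintype Ω] {n : ℕ} {K : W → Ω → ℝ}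
    (hK1 : ∀ w, ∑ a, K w a = 1) (c : ℝ) (w : Fin n → W) : Kn K (fun _ => c) w = c := by
  induction n with
  | zero => rw [Kn_zero]
  | succ n ih =>
    rw [← Fin.cons_self_tail w, Kn_succ]
    simp only [ih]; rw [← Finset.sum_mul, hK1, one_mul]

lemma Kn_mem {Ω W : Type} [Fintype Ω] {n : ℕ} {K : W → Ω → ℝ} (hK : ∀ w a, 0 ≤ K w a)
    (hK1 : ∀ w, ∑ a, K w a = 1) {g : (Fin n → Ω) → ℝ} (hg : ∀ v, g v ∈ Set.Icc (0:ℝ) 1)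
    (w : Fin n → W) : Kn K g w ∈ Set.Icc (0:ℝ) 1 := by
  constructor
  · rw [← Kn_const hK1 0 w]; exact Kn_mono hK (fun v => (hg v).1) w
  · rw [← Kn_const hK1 1 w]; exact Kn_mono hK (fun v => (hg v).2) w

lemma exps_Kn {Ω W : Type} [Fintype Ω] [Fintype W] {n : ℕ} {K : W → Ω → ℝ}
    {ν : W → ℝ} {p : Ω → ℝ} (hst : ∀ a, ∑ w, ν w * K w a = p a) (g : (Fin n → Ω) → ℝ) :
    exps ν (Kn K g) = exps p g := by
  induction n with
  | zero => rw [exps_zero, exps_zero, Kn_zero]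
  | succ n ih =>
    rw [exps_succ, exps_succ]
    have : ∀ w : W, exps ν (fun v => Kn K g (Fin.cons w v)) =
        ∑ a, K w a * exps p (fun v => g (Fin.cons a v)) := by
      intro w
      simp only [Kn_succ]
      rw [exps_sum]
      refine Finset.sum_congr rfl fun a _ => ?_
      rw [exps_mul_left, ih]
    simp only [this, Finset.mul_sum]
    rw [Finset.sum_comm]
    refine Finset.sum_congr rfl fun a _ => ?_
    rw [← hst, Finset.sum_mul]
    exact Finset.sum_congr rfl fun w _ => by ring

/-! ### Kernels with a spectral gap; the single-site inequality -/

structure Ker {Ω W : Type} [Fintype Ω] [Fintype W] (K : W → Ω → ℝ) (ν : W → ℝ) (p : Ω → ℝ)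
    (r : ℝ) : Prop where
  Knn : ∀ w a, 0 ≤ K w a
  K1 : ∀ w, ∑ a, K w a = 1
  νnn : ∀ w, 0 ≤ ν w
  ν1 : ∑ w, ν w = 1
  ppos : ∀ a, 0 < p a
  p1 : ∑ a, p a = 1
  st : ∀ a, ∑ w, ν w * K w a = p a
  r0 : 0 ≤ r
  r1 : r < 1
  gap : ∀ f : Ω → ℝ, ∑ a, p a * f a = 0 →
    ∑ w, ν w * (∑ a, K w a * f a) ^ 2 ≤ r ^ 2 * ∑ a, p a * f a ^ 2

lemma Ker.stf {Ω W : Type} [Fintype Ω] [Fintype W] {K : W → Ω → ℝ} {ν : W → ℝ} {p : Ω → ℝ}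
    {r : ℝ} (h : Ker K ν p r) (f : Ω → ℝ) :
    ∑ w, ν w * ∑ a, K w a * f a = ∑ a, p a * f a := by
  simp only [Finset.mul_sum]
  rw [Finset.sum_comm]
  refine Finset.sum_congr rfl fun a _ => ?_
  rw [← h.st, Finset.sum_mul]
  exact Finset.sum_congr rfl fun w _ => by ring

lemma log_taylor {x : ℝ} (hx : |x| ≤ 1/2) :
    |Real.log (1 + x) - (x - x^2/2)| ≤ 2 * |x|^3 := by
  have h := Real.abs_log_sub_add_sum_range_le (x := -x) (by rw [abs_neg]; linarith) 2
  simp only [Finset.sum_range_succ, Finset.sum_range_zero, abs_neg, sub_neg_eq_add] at h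
  norm_num at h
  have h2 : |x|^3 / (1 - |x|) ≤ 2 * |x|^3 := by
    rw [div_le_iff₀ (by linarith)]
    nlinarith [pow_nonneg (abs_nonneg x) 3]
  calc _ = |-x + x^2/2 + Real.log (1+x)| := by congr 1; ring
    _ ≤ _ := h.trans h2

lemma log_abs_le {x : ℝ} (hx : |x| ≤ 1/4) : (Real.log (1 + x))^2 ≤ 4 * x^2 := by
  have h := log_taylor (x := x) (by linarith)
  have h1 : |Real.log (1+x)| ≤ 2 * |x| := by
    have : |Real.log (1+x)| ≤ |x - x^2/2| + 2 * |x|^3 := by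
      have := abs_sub_abs_le_abs_sub (Real.log (1+x)) (x - x^2/2)
      linarith
    have h3 : |x - x^2/2| ≤ |x| + |x|^2/2 := by
      have := abs_sub x (x^2/2)
      rw [abs_div, abs_pow] at this; norm_num at this; simpa using this
    nlinarith [abs_nonneg x, mul_nonneg (abs_nonneg x) (abs_nonneg x), sq_nonneg (|x|),
      mul_nonneg (mul_nonneg (abs_nonneg x) (abs_nonneg x)) (abs_nonneg x)]
  calc _ = |Real.log (1+x)|^2 := (sq_abs _).symm
    _ ≤ (2*|x|)^2 := by gcongr
    _ = _ := by rw [mul_pow, sq_abs]; norm_num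

/-- Jensen for the logarithm. -/
lemma log_jensen {Ω : Type} [Fintype Ω] {k G : Ω → ℝ} (hk : ∀ a, 0 ≤ k a) (hk1 : ∑ a, k a = 1)
    (hG : ∀ a, 0 ≤ G a) {κ : ℝ} (hκ : 0 < κ) :
    ∑ a, k a * Real.log (G a + κ) ≤ Real.log (∑ a, k a * G a + κ) := by
  set y := ∑ a, k a * G a + κ with hy
  have hy0 : 0 < y := by
    have : 0 ≤ ∑ a, k a * G a := Finset.sum_nonneg fun a _ => mul_nonneg (hk a) (hG a)
    linarith
  have h1 : ∀ a, Real.log (G a + κ) ≤ Real.log y + (G a + κ - y) / y := by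
    intro a
    have hx0 : 0 < G a + κ := by have := hG a; linarith
    have := Real.log_le_sub_one_of_pos (div_pos hx0 hy0)
    rw [Real.log_div hx0.ne' hy0.ne'] at this
    have e : (G a + κ - y)/y = (G a + κ)/y - 1 := by field_simp
    linarith
  calc _ ≤ ∑ a, k a * (Real.log y + (G a + κ - y) / y) :=
        Finset.sum_le_sum fun a _ => mul_le_mul_of_nonneg_left (h1 a) (hk a)
    _ = ∑ a, (k a * Real.log y + (k a * G a + k a * κ - k a * y) / y) :=
        Finset.sum_congr rfl fun a _ => by ring
    _ = Real.log y := by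
      rw [Finset.sum_add_distrib, ← Finset.sum_mul, hk1, ← Finset.sum_div,
        Finset.sum_sub_distrib, Finset.sum_add_distrib, ← Finset.sum_mul, ← Finset.sum_mul, hk1]
      rw [show ∑ a, k a * G a + 1 * κ - 1 * y = 0 by rw [hy]; ring]
      simp

lemma var_le {Ω : Type} [Fintype Ω] {p Z : Ω → ℝ} (hp1 : ∑ a, p a = 1) (c : ℝ) :
    ∑ a, p a * (Z a - ∑ b, p b * Z b) ^ 2 ≤ ∑ a, p a * (Z a - c) ^ 2 := by
  set m := ∑ b, p b * Z b with hm
  have e : ∑ a, p a * (Z a - c) ^ 2 = ∑ a, p a * (Z a - m)^2 + (m - c)^2 := by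
    have : ∀ a, p a * (Z a - c) ^ 2 = p a * (Z a - m)^2 + (2 * (m-c)) * (p a * Z a)
        + p a * ((m - c)^2 - 2 * (m-c) * m) := fun a => by ring
    simp only [this, Finset.sum_add_distrib, ← Finset.mul_sum, ← Finset.sum_mul, hp1, ← hm]
    ring
  rw [e]; nlinarith [sq_nonneg (m-c)]

noncomputable def cJump (r κ pm : ℝ) : ℝ :=
  (|Real.log κ| + 1)^2 / (pm * κ^4 * ((1-r^2)/16)^4)

lemma single_site {Ω W : Type} [Fintype Ω] [Fintype W] {K : W → Ω → ℝ} {ν : W → ℝ} {p : Ω → ℝ}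
    {r : ℝ} (h : Ker K ν p r) {pm : ℝ} (hpm0 : 0 < pm) (hpm : ∀ a, pm ≤ p a)
    {κ : ℝ} (hκ : 0 < κ) (hκ1 : κ ≤ 1) {G : Ω → ℝ} (hG : ∀ a, G a ∈ Set.Icc (0:ℝ) 1) :
    ∑ a, p a * (Real.log (G a + κ) - ∑ b, p b * Real.log (G b + κ)) ^ 2 ≤
      16/(1-r^2) * (∑ w, ν w * Real.log (∑ a, K w a * G a + κ) - ∑ a, p a * Real.log (G a + κ))
      + cJump r κ pm * ∑ a, p a * (G a - ∑ b, p b * G b)^4 := by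
  have hr2 : 0 < 1 - r^2 := by nlinarith [h.r0, h.r1]
  have hgap : 0 ≤ ∑ w, ν w * Real.log (∑ a, K w a * G a + κ) - ∑ a, p a * Real.log (G a + κ) := by
    rw [← h.stf (fun a => Real.log (G a + κ)), ← Finset.sum_sub_distrib]
    refine Finset.sum_nonneg fun w _ => ?_
    rw [← mul_sub]
    refine mul_nonneg (h.νnn w) (sub_nonneg.2 ?_)
    exact log_jensen (h.Knn w) (h.K1 w) (fun a => (hG a).1) hκ
  have hcJ : 0 ≤ cJump r κ pm := by unfold cJump; positivity
  set m := ∑ b, p b * G b with hm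
  have hm0 : 0 ≤ m := Finset.sum_nonneg fun a _ => mul_nonneg (h.ppos a).le (hG a).1
  set A := m + κ with hA
  have hA0 : 0 < A := by linarith
  set c0 := (1 - r^2)/16 with hc0
  have hc0p : 0 < c0 := by positivity
  have hc01 : c0 ≤ 1/16 := by rw [hc0]; nlinarith [sq_nonneg r]
  by_cases hc : ∀ a, |(G a - m)/A| ≤ c0
  · -- small fluctuations
    set ξ : Ω → ℝ := fun a => (G a - m)/A with hξ
    have hGξ : ∀ a, G a + κ = A * (1 + ξ a) := by
      intro a; simp only [hξ, hA]; field_simp; ring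
    have hξ0 : ∑ a, p a * ξ a = 0 := by
      have : ∀ a, p a * ξ a = (p a * G a - p a * m)/A := fun a => by simp only [hξ]; ring
      simp only [this]
      rw [← Finset.sum_div, Finset.sum_sub_distrib, ← Finset.sum_mul, h.p1, ← hm]; simp
    set v : W → ℝ := fun w => ∑ a, K w a * ξ a with hv
    have hKv : ∀ w, ∑ a, K w a * G a + κ = A * (1 + v w) := by
      intro w
      have : ∀ a, K w a * G a = K w a * m + A * (K w a * ξ a) := by
        intro a; have := hGξ a; have : G a = A * (1 + ξ a) - κ := by linarith
        rw [this, hA]; ring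
      simp only [this, Finset.sum_add_distrib, ← Finset.mul_sum, ← Finset.sum_mul, h.K1]
      simp only [hv, hA]; ring
    have hvb : ∀ w, |v w| ≤ c0 := by
      intro w
      calc |v w| ≤ ∑ a, |K w a * ξ a| := Finset.abs_sum_le_sum_abs _ _
        _ ≤ ∑ a, K w a * c0 := Finset.sum_le_sum fun a _ => by
            rw [abs_mul, abs_of_nonneg (h.Knn w a)]
            exact mul_le_mul_of_nonneg_left (hc a) (h.Knn w a)
        _ = c0 := by rw [← Finset.sum_mul, h.K1, one_mul]
    have hlogG : ∀ a, Real.log (G a + κ) = Real.log A + Real.log (1 + ξ a) := by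
      intro a
      have := abs_le.1 (hc a)
      rw [hGξ, Real.log_mul hA0.ne' (by simp only [hξ]; linarith)]
    have hlogv : ∀ w, Real.log (∑ a, K w a * G a + κ) = Real.log A + Real.log (1 + v w) := by
      intro w
      have := abs_le.1 (hvb w)
      rw [hKv, Real.log_mul hA0.ne' (by linarith)]
    have hvv := h.gap ξ hξ0
    have hv0 : ∑ w, ν w * v w = 0 := by rw [← hξ0]; exact h.stf ξ
    have cub : ∀ x : ℝ, |x| ≤ c0 → |x|^3 ≤ c0 * x^2 := by
      intro x hx; rw [← sq_abs x]; nlinarith [sq_nonneg |x|]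
    have up : ∑ a, p a * Real.log (1 + ξ a) ≤ -(1/2 - 2*c0) * ∑ a, p a * ξ a^2 := by
      calc _ ≤ ∑ a, (p a * ξ a + -(1/2 - 2*c0) * (p a * ξ a^2)) := by
            refine Finset.sum_le_sum fun a _ => ?_
            have h1 := (abs_le.1 (log_taylor (x := ξ a) ((hc a).trans (by linarith)))).2
            have h2 := cub _ (hc a)
            have : Real.log (1 + ξ a) ≤ ξ a - (1/2 - 2*c0) * ξ a^2 := by
              simp only [hξ] at *; nlinarith
            nlinarith [h.ppos a]
        _ = _ := by rw [Finset.sum_add_distrib, hξ0, ← Finset.mul_sum]; ring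
    have lo : -(1/2 + 2*c0) * ∑ w, ν w * v w^2 ≤ ∑ w, ν w * Real.log (1 + v w) := by
      calc -(1/2 + 2*c0) * ∑ w, ν w * v w^2
          = ∑ w, (ν w * v w + -(1/2 + 2*c0) * (ν w * v w^2)) := by
            rw [Finset.sum_add_distrib, hv0, ← Finset.mul_sum]; ring
        _ ≤ _ := by
            refine Finset.sum_le_sum fun w _ => ?_
            have h1 := (abs_le.1 (log_taylor (x := v w) ((hvb w).trans (by linarith)))).1
            have h2 := cub _ (hvb w)
            have : v w - (1/2 + 2*c0) * v w^2 ≤ Real.log (1 + v w) := by nlinarith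
            nlinarith [h.νnn w]
    set E := ∑ a, p a * ξ a^2 with hE
    have hE0 : 0 ≤ E := Finset.sum_nonneg fun a _ => mul_nonneg (h.ppos a).le (sq_nonneg _)
    have hsplit1 : ∑ a, p a * Real.log (G a + κ) = Real.log A + ∑ a, p a * Real.log (1 + ξ a) := by
      simp only [hlogG, mul_add, Finset.sum_add_distrib, ← Finset.sum_mul, h.p1, one_mul]
    have hsplit2 : ∑ w, ν w * Real.log (∑ a, K w a * G a + κ)
        = Real.log A + ∑ w, ν w * Real.log (1 + v w) := by
      simp only [hlogv, mul_add, Finset.sum_add_distrib, ← Finset.sum_mul, h.ν1, one_mul]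
    have hg : (1-r^2)/4 * E ≤
        ∑ w, ν w * Real.log (∑ a, K w a * G a + κ) - ∑ a, p a * Real.log (G a + κ) := by
      rw [hsplit1, hsplit2]
      have h5 : (1/2 + 2*c0) * ∑ w, ν w * v w^2 ≤ (1/2 + 2*c0) * (r^2 * E) :=
        mul_le_mul_of_nonneg_left hvv (by positivity)
      have h6 : 2 * c0 * (r^2 * E) ≤ 2 * c0 * E := by
        have : r^2 * E ≤ E := by nlinarith
        nlinarith
      rw [hc0] at *
      nlinarith
    have hvar : ∑ a, p a * (Real.log (G a + κ) - ∑ b, p b * Real.log (G b + κ)) ^ 2 ≤ 4 * E := by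
      refine (var_le h.p1 (Real.log A)).trans ?_
      rw [hE, Finset.mul_sum]
      refine Finset.sum_le_sum fun a _ => ?_
      rw [hlogG]
      have := log_abs_le (x := ξ a) ((hc a).trans (by linarith))
      have e : Real.log A + Real.log (1 + ξ a) - Real.log A = Real.log (1 + ξ a) := by ring
      rw [e]
      nlinarith [h.ppos a]
    have h4 : 0 ≤ ∑ a, p a * (G a - m)^4 :=
      Finset.sum_nonneg fun a _ => mul_nonneg (h.ppos a).le (by positivity)
    have : 4 * E ≤ 16/(1-r^2) * (∑ w, ν w * Real.log (∑ a, K w a * G a + κ)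
        - ∑ a, p a * Real.log (G a + κ)) := by
      rw [div_mul_eq_mul_div, le_div_iff₀ hr2]; linarith
    have := mul_nonneg hcJ h4
    linarith
  · -- a jump
    push Not at hc
    obtain ⟨a0, ha0⟩ := hc
    have hM : ∀ a, (Real.log (G a + κ) - 0)^2 ≤ (|Real.log κ| + 1)^2 := by
      intro a
      rw [sub_zero, ← sq_abs]
      have h1 : Real.log κ ≤ Real.log (G a + κ) := Real.log_le_log hκ (by linarith [(hG a).1])
      have h2 : Real.log (G a + κ) ≤ 1 := by
        have := Real.log_le_sub_one_of_pos (x := G a + κ) (by linarith [(hG a).1])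
        linarith [(hG a).2]
      have : |Real.log (G a + κ)| ≤ |Real.log κ| + 1 := by
        rw [abs_le]
        constructor
        · have := neg_abs_le (Real.log κ); linarith
        · have := abs_nonneg (Real.log κ); linarith
      gcongr
    have hvar : ∑ a, p a * (Real.log (G a + κ) - ∑ b, p b * Real.log (G b + κ)) ^ 2
        ≤ (|Real.log κ| + 1)^2 := by
      refine (var_le h.p1 0).trans ?_
      calc _ ≤ ∑ a, p a * (|Real.log κ| + 1)^2 :=
            Finset.sum_le_sum fun a _ => mul_le_mul_of_nonneg_left (hM a) (h.ppos a).le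
        _ = _ := by rw [← Finset.sum_mul, h.p1, one_mul]
    have h4 : pm * κ^4 * c0^4 ≤ ∑ a, p a * (G a - m)^4 := by
      calc pm * κ^4 * c0^4 ≤ p a0 * (G a0 - m)^4 := by
            rw [abs_div, abs_of_pos hA0, lt_div_iff₀ hA0] at ha0
            have h7 : κ * c0 ≤ |G a0 - m| := by
              have : κ * c0 ≤ c0 * A := by rw [hA]; nlinarith
              linarith
            have h8 : (κ * c0)^4 ≤ (G a0 - m)^4 := by
              rw [← Even.pow_abs (n := 4) (by decide) (G a0 - m)]; gcongr
            rw [mul_pow] at h8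
            rw [mul_assoc]
            exact mul_le_mul (hpm a0) h8 (by positivity) (h.ppos a0).le
        _ ≤ _ := Finset.single_le_sum (f := fun a => p a * (G a - m)^4)
            (fun a _ => mul_nonneg (h.ppos a).le (by positivity)) (Finset.mem_univ a0)
    have h9 : (|Real.log κ| + 1)^2 ≤ cJump r κ pm * ∑ a, p a * (G a - m)^4 := by
      unfold cJump
      rw [div_mul_eq_mul_div, le_div_iff₀ (by positivity)]
      exact mul_le_mul_of_nonneg_left h4 (by positivity)
    have := mul_nonneg (by positivity : 0 ≤ 16/(1-r^2)) hgap
    linarith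

/-! ### The induction lemma -/

lemma exps_sq_add {Ω : Type} [Fintype Ω] {n : ℕ} (p : Ω → ℝ) (f g : (Fin n → Ω) → ℝ) :
    exps p (fun v => (f v + g v)^2) =
      exps p (fun v => f v ^ 2) + 2 * exps p (fun v => f v * g v) + exps p (fun v => g v ^ 2) := by
  rw [← exps_mul_left, ← exps_add, ← exps_add]
  congr 1; funext v; ring

/-- Sum of the fourth moments of the martingale increments. -/
noncomputable def Qf {Ω : Type} [Fintype Ω] {n : ℕ} (p : Ω → ℝ) (g : (Fin n → Ω) → ℝ) : ℝ :=
  ∑ i, exps p (fun v => (g v - ∑ a, p a * g (Function.update v i a))^4)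

lemma Qf_succ {Ω : Type} [Fintype Ω] {n : ℕ} (p : Ω → ℝ) (g : (Fin (n+1) → Ω) → ℝ) :
    Qf p g = exps p (fun x => ∑ a, p a * (g (Fin.cons a x) - ∑ b, p b * g (Fin.cons b x))^4)
      + ∑ a, p a * Qf p (fun v => g (Fin.cons a v)) := by
  unfold Qf
  rw [Fin.sum_univ_succ, exps_succ]
  simp only [Fin.update_cons_zero, Finset.mul_sum]
  rw [exps_sum]
  congr 1
  · refine Finset.sum_congr rfl fun a _ => ?_
    rw [exps_mul_left]
  · rw [Finset.sum_comm]
    refine Finset.sum_congr rfl fun i _ => ?_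
    rw [exps_succ]
    refine Finset.sum_congr rfl fun a _ => ?_
    simp only [Fin.cons_update]

lemma Qf_jensen {Ω W : Type} [Fintype Ω] [Fintype W] {K : W → Ω → ℝ} {ν : W → ℝ} {p : Ω → ℝ}
    {r : ℝ} (h : Ker K ν p r) {n : ℕ} (g : (Fin (n+1) → Ω) → ℝ) :
    ∑ w, ν w * Qf p (fun v => ∑ a, K w a * g (Fin.cons a v)) ≤
      ∑ a, p a * Qf p (fun v => g (Fin.cons a v)) := by
  rw [← h.stf (fun a => Qf p (fun v => g (Fin.cons a v)))]
  refine Finset.sum_le_sum fun w _ => mul_le_mul_of_nonneg_left ?_ (h.νnn w)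
  unfold Qf
  simp only [Finset.mul_sum]
  rw [Finset.sum_comm]
  refine Finset.sum_le_sum fun i _ => ?_
  simp only [← exps_mul_left]
  rw [← exps_sum]
  refine exps_mono (fun a => (h.ppos a).le) fun v => ?_
  have e : ∑ a, K w a * g (Fin.cons a v) -
      ∑ b, ∑ a, p b * (K w a * g (Fin.cons a (Function.update v i b))) =
      ∑ a, K w a * (g (Fin.cons a v) - ∑ b, p b * g (Fin.cons a (Function.update v i b))) := by
    rw [Finset.sum_comm, ← Finset.sum_sub_distrib]
    refine Finset.sum_congr rfl fun a _ => ?_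
    rw [mul_sub, Finset.mul_sum]
    congr 1
    exact Finset.sum_congr rfl fun b _ => by ring
  rw [e]
  exact Real.pow_arith_mean_le_arith_mean_pow_of_even _ _ _ (fun a _ => h.Knn w a) (h.K1 w)
    (by decide)

lemma Qf_nonneg {Ω : Type} [Fintype Ω] {n : ℕ} {p : Ω → ℝ} (hp : ∀ a, 0 ≤ p a)
    (g : (Fin n → Ω) → ℝ) : 0 ≤ Qf p g := by
  unfold Qf
  exact Finset.sum_nonneg fun i _ => exps_nonneg hp fun v => by positivity

lemma cJump_nonneg {r κ pm : ℝ} (hpm : 0 < pm) : 0 ≤ cJump r κ pm := by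
  unfold cJump
  have : 0 ≤ ((1-r^2)/16)^4 := by positivity
  positivity

lemma induction_lemma {Ω W : Type} [Fintype Ω] [Fintype W] {K : W → Ω → ℝ} {ν : W → ℝ} {p : Ω → ℝ}
    {r : ℝ} (h : Ker K ν p r) {pm : ℝ} (hpm0 : 0 < pm) (hpm : ∀ a, pm ≤ p a)
    {κ : ℝ} (hκ : 0 < κ) (hκ1 : κ ≤ 1) (n : ℕ) :
    ∀ g : (Fin n → Ω) → ℝ, (∀ v, g v ∈ Set.Icc (0:ℝ) 1) →
    ∃ V : ℝ, ∃ B E : (Fin n → W) → (Fin n → Ω) → ℝ,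
      (∀ w x, Real.log (g x + κ) + B w x + E w x ≤ Real.log (Kn K g w + κ)) ∧
      (∀ x, exps ν (fun w => B w x) = 0) ∧
      exps ν (fun w => exps p (fun x => (B w x)^2)) ≤ V ∧
      exps ν (fun w => exps p (fun x => (E w x)^2)) ≤ V ∧
      V ≤ 16/(1-r^2) * (exps ν (fun w => Real.log (Kn K g w + κ))
        - exps p (fun x => Real.log (g x + κ))) + cJump r κ pm * Qf p g := by
  induction n with
  | zero =>
    intro g hg
    refine ⟨0, fun _ _ => 0, fun _ _ => 0, ?_, ?_, ?_, ?_, ?_⟩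
    · intro w x
      rw [Kn_zero, Subsingleton.elim x Fin.elim0]; simp
    · intro x; rw [exps_zero]
    · rw [exps_zero, exps_zero]; simp
    · rw [exps_zero, exps_zero]; simp
    · rw [exps_zero, exps_zero, Kn_zero]; simp [Qf]
  | succ n ih =>
    intro g hg
    have hpn : ∀ a, 0 ≤ p a := fun a => (h.ppos a).le
    have hGm : ∀ w (v : Fin n → Ω), ∑ a, K w a * g (Fin.cons a v) ∈ Set.Icc (0:ℝ) 1 := by
      intro w v
      constructor
      · exact Finset.sum_nonneg fun a _ => mul_nonneg (h.Knn w a) (hg _).1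
      · calc _ ≤ ∑ a, K w a * 1 := Finset.sum_le_sum fun a _ =>
              mul_le_mul_of_nonneg_left (hg _).2 (h.Knn w a)
          _ = 1 := by simp [h.K1 w]
    choose V B E h1 h2 h3 h4 h5 using fun w1 : W =>
      ih (fun v => ∑ a, K w1 a * g (Fin.cons a v)) (hGm w1)
    set ps : Ω → (Fin n → Ω) → ℝ := fun a x => Real.log (g (Fin.cons a x) + κ) with hps
    set mm : (Fin n → Ω) → ℝ := fun x => ∑ a, p a * ps a x with hmm
    set b : W → (Fin n → Ω) → ℝ := fun w x => ∑ a, K w a * ps a x - mm x with hb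
    set vr : (Fin n → Ω) → ℝ := fun x => ∑ a, p a * (ps a x - mm x)^2 with hvr
    have hmean : ∀ x, ∑ a, p a * (ps a x - mm x) = 0 := by
      intro x
      simp only [mul_sub, Finset.sum_sub_distrib, ← Finset.sum_mul, h.p1, one_mul]
      rw [hmm]; ring
    have hb' : ∀ w x, b w x = ∑ a, K w a * (ps a x - mm x) := by
      intro w x
      simp only [mul_sub, Finset.sum_sub_distrib, ← Finset.sum_mul, h.K1 w, one_mul]
      rw [hb]
    have hbmean : ∀ x, ∑ w, ν w * b w x = 0 := by
      intro x
      simp only [hb']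
      rw [h.stf (fun a => ps a x - mm x), hmean]
    have hbvar : ∀ x, ∑ w, ν w * b w x ^ 2 ≤ vr x := by
      intro x
      simp only [hb']
      refine (h.gap _ (hmean x)).trans ?_
      have h0 : 0 ≤ vr x := Finset.sum_nonneg fun a _ => mul_nonneg (hpn a) (sq_nonneg _)
      have : r^2 ≤ 1 := by nlinarith [h.r0, h.r1]
      change r^2 * vr x ≤ vr x
      nlinarith
    have cons_lem : ∀ {α : Type} {k : ℕ} (v : Fin (k+1) → α), Fin.cons (v 0) (Fin.tail v) = v :=
      fun v => Fin.cons_self_tail v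
    refine ⟨exps p vr + ∑ w, ν w * V w, fun w x => B (w 0) (Fin.tail w) (Fin.tail x) + b (w 0) (Fin.tail x),
      fun w x => E (w 0) (Fin.tail w) (Fin.tail x) + (mm (Fin.tail x) - ps (x 0) (Fin.tail x)),
      ?_, ?_, ?_, ?_, ?_⟩
    · intro w x
      rw [← cons_lem w, ← cons_lem x]
      generalize w 0 = w0; generalize x 0 = x0; generalize Fin.tail w = ws
      generalize Fin.tail x = xs
      rw [Kn_succ']
      simp only [Fin.cons_zero, Fin.tail_cons]
      have a1 := h1 w0 ws xs
      have a2 := log_jensen (h.Knn w0) (h.K1 w0) (G := fun a => g (Fin.cons a xs))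
        (fun a => (hg _).1) hκ
      simp only [hb, hps] at *
      linarith
    · intro x
      rw [exps_succ]
      simp only [Fin.cons_zero, Fin.tail_cons, exps_add, h2, exps_const h.ν1, zero_add, hbmean]
    · rw [exps_succ]
      have e1 : ∀ (w0 : W) (ws : Fin n → W), exps p (fun x : Fin (n+1) → Ω =>
          (B w0 ws (Fin.tail x) + b w0 (Fin.tail x))^2) =
          exps p (fun x => (B w0 ws x + b w0 x)^2) := by
        intro w0 ws
        rw [exps_succ]
        simp only [Fin.tail_cons]
        rw [← Finset.sum_mul, h.p1, one_mul]
      simp only [Fin.cons_zero, Fin.tail_cons, e1, exps_sq_add]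
      have e2 : ∀ w0, exps ν (fun ws => exps p (fun x => B w0 ws x * b w0 x)) = 0 := by
        intro w0
        rw [← exps_swap]
        simp only [exps_mul_right, h2, zero_mul, exps_const h.p1]
      simp only [exps_add, exps_mul_left, e2, exps_const h.ν1]
      have e3 : ∑ w, ν w * exps p (fun x => b w x ^ 2) ≤ exps p vr := by
        simp only [← exps_mul_left]
        rw [← exps_sum]
        exact exps_mono hpn hbvar
      have e4 : ∑ w, ν w * exps ν (fun ws => exps p (fun x => B w ws x ^ 2)) ≤ ∑ w, ν w * V w :=
        Finset.sum_le_sum fun w _ => mul_le_mul_of_nonneg_left (h3 w) (h.νnn w)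
      simp only [mul_zero, add_zero, mul_add, Finset.sum_add_distrib]
      linarith
    · rw [exps_succ]
      have e1 : ∀ (w0 : W) (ws : Fin n → W), exps p (fun x : Fin (n+1) → Ω =>
          (E w0 ws (Fin.tail x) + (mm (Fin.tail x) - ps (x 0) (Fin.tail x)))^2) =
          exps p (fun x => E w0 ws x ^2) + exps p vr := by
        intro w0 ws
        rw [exps_succ]
        simp only [Fin.tail_cons, Fin.cons_zero, ← exps_mul_left]
        rw [← exps_sum, ← exps_add]
        congr 1; funext x
        have : ∀ a, p a * (E w0 ws x + (mm x - ps a x))^2 =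
          p a * E w0 ws x ^ 2 + (-2 * E w0 ws x) * (p a * (ps a x - mm x)) +
            p a * (ps a x - mm x)^2 := fun a => by ring
        simp only [this, Finset.sum_add_distrib, ← Finset.mul_sum, ← Finset.sum_mul, h.p1, hmean]
        simp only [hvr]; ring
      simp only [Fin.cons_zero, Fin.tail_cons, e1]
      simp only [exps_add, exps_const h.ν1]
      have e4 : ∑ w, ν w * exps ν (fun ws => exps p (fun x => E w ws x ^ 2)) ≤ ∑ w, ν w * V w :=
        Finset.sum_le_sum fun w _ => mul_le_mul_of_nonneg_left (h4 w) (h.νnn w)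
      simp only [mul_add, Finset.sum_add_distrib]
      rw [← Finset.sum_mul, h.ν1]
      linarith
    · have s1 : exps p vr ≤ 16/(1-r^2) * (∑ w, ν w * exps p (fun x =>
            Real.log (∑ a, K w a * g (Fin.cons a x) + κ)) - exps p mm) + cJump r κ pm *
            exps p (fun x => ∑ a, p a * (g (Fin.cons a x) - ∑ b, p b * g (Fin.cons b x))^4) := by
        simp only [← exps_mul_left]
        rw [← exps_sum, ← exps_sub, ← exps_mul_left, ← exps_add]
        refine exps_mono hpn fun x => ?_
        exact single_site h hpm0 hpm hκ hκ1 (G := fun a => g (Fin.cons a x)) (fun a => hg _)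
      have s2 : ∑ w, ν w * V w ≤ ∑ w, ν w * (16/(1-r^2) * (exps ν (fun ws => Real.log
          (Kn K (fun v => ∑ a, K w a * g (Fin.cons a v)) ws + κ)) - exps p (fun x =>
            Real.log (∑ a, K w a * g (Fin.cons a x) + κ))) +
            cJump r κ pm * Qf p (fun v => ∑ a, K w a * g (Fin.cons a v))) :=
        Finset.sum_le_sum fun w _ => mul_le_mul_of_nonneg_left (h5 w) (h.νnn w)
      have s3 := Qf_jensen h g
      have s4 : ∑ w, ν w * (16/(1-r^2) * (exps ν (fun ws => Real.log
          (Kn K (fun v => ∑ a, K w a * g (Fin.cons a v)) ws + κ)) - exps p (fun x =>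
            Real.log (∑ a, K w a * g (Fin.cons a x) + κ))) +
            cJump r κ pm * Qf p (fun v => ∑ a, K w a * g (Fin.cons a v))) =
          16/(1-r^2) * (∑ w, ν w * exps ν (fun ws => Real.log
          (Kn K (fun v => ∑ a, K w a * g (Fin.cons a v)) ws + κ)) - ∑ w, ν w * exps p (fun x =>
            Real.log (∑ a, K w a * g (Fin.cons a x) + κ))) +
            cJump r κ pm * ∑ w, ν w * Qf p (fun v => ∑ a, K w a * g (Fin.cons a v)) := by
        rw [← Finset.sum_sub_distrib, Finset.mul_sum, Finset.mul_sum, ← Finset.sum_add_distrib]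
        exact Finset.sum_congr rfl fun w _ => by ring
      rw [Qf_succ, exps_succ, exps_succ]
      simp only [Kn_succ']
      have s5 : exps p mm = ∑ a, p a * exps p (ps a) := by
        simp only [hmm, ← exps_mul_left]; rw [exps_sum]
      simp only [hps] at s5
      have s6 := mul_le_mul_of_nonneg_left s3 (cJump_nonneg (r := r) (κ := κ) hpm0)
      rw [s4] at s2
      rw [s5] at s1
      simp only [mul_sub, mul_add] at *
      linarith

/-! ### Fourier analysis on product spaces -/

lemma sum_pi_prod {ι : Type} [Fintype ι] {n : ℕ} (F : Fin n → ι → ℝ) :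
    ∑ s : Fin n → ι, ∏ i, F i (s i) = ∏ i, ∑ a, F i a := by
  rw [Finset.prod_univ_sum, Fintype.piFinset_univ]

lemma exps_prod {Ω : Type} [Fintype Ω] {n : ℕ} (p : Ω → ℝ) (F : Fin n → Ω → ℝ) :
    exps p (fun v => ∏ i, F i (v i)) = ∏ i, ∑ a, p a * F i a := by
  unfold exps
  simp only [← Finset.prod_mul_distrib]
  exact sum_pi_prod (fun i a => p a * F i a)

lemma Kn_prod {Ω W : Type} [Fintype Ω] {n : ℕ} (K : W → Ω → ℝ) (F : Fin n → Ω → ℝ)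
    (w : Fin n → W) :
    Kn K (fun v => ∏ i, F i (v i)) w = ∏ i, ∑ a, K (w i) a * F i a := by
  unfold Kn
  simp only [← Finset.prod_mul_distrib]
  exact sum_pi_prod (fun i a => K (w i) a * F i a)

structure FB {Ω ι : Type} [Fintype Ω] [Fintype ι] [DecidableEq ι] (p : Ω → ℝ) (φ : ι → Ω → ℝ)
    (z : ι) : Prop where
  one : ∀ x, φ z x = 1
  orth : ∀ a b, ∑ x, p x * (φ a x * φ b x) = if a = b then 1 else 0
  compl : ∀ x y, x ≠ y → ∑ a, φ a x * φ a y = 0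
  compl1 : ∀ x, p x * ∑ a, φ a x * φ a x = 1

/-- Degree. -/
def dg {ι : Type} [DecidableEq ι] (z : ι) {n : ℕ} (s : Fin n → ι) : ℕ :=
  (Finset.univ.filter (fun i => s i ≠ z)).card

/-- Basis element. -/
def ph {Ω ι : Type} (φ : ι → Ω → ℝ) {n : ℕ} (s : Fin n → ι) (v : Fin n → Ω) : ℝ :=
  ∏ i, φ (s i) (v i)

/-- Fourier coefficient. -/
noncomputable def hat {Ω ι : Type} [Fintype Ω] (p : Ω → ℝ) (φ : ι → Ω → ℝ) {n : ℕ}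
    (f : (Fin n → Ω) → ℝ) (s : Fin n → ι) : ℝ := exps p (fun v => f v * ph φ s v)

section fourier
variable {Ω ι : Type} [Fintype Ω] [Fintype ι] [DecidableEq ι] {p : Ω → ℝ} {φ : ι → Ω → ℝ} {z : ι}

lemma FB.inversion (h : FB p φ z) {n : ℕ} (f : (Fin n → Ω) → ℝ) (x : Fin n → Ω) :
    f x = ∑ s, hat p φ f s * ph φ s x := by
  classical
  unfold hat exps ph
  simp only [Finset.sum_mul]
  rw [Finset.sum_comm]
  have e : ∀ v : Fin n → Ω, ∑ s : Fin n → ι, (∏ i, p (v i)) * (f v * ∏ i, φ (s i) (v i)) *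
      ∏ i, φ (s i) (x i) = f v * if v = x then 1 else 0 := by
    intro v
    have : ∀ s : Fin n → ι, (∏ i, p (v i)) * (f v * ∏ i, φ (s i) (v i)) * ∏ i, φ (s i) (x i)
        = f v * ∏ i, (p (v i) * (φ (s i) (v i) * φ (s i) (x i))) := by
      intro s; simp only [Finset.prod_mul_distrib]; ring
    simp only [this, ← Finset.mul_sum]
    rw [sum_pi_prod (fun i a => p (v i) * (φ a (v i) * φ a (x i)))]
    congr 1
    split_ifs with hv
    · subst hv
      refine Finset.prod_eq_one fun i _ => ?_
      rw [← Finset.mul_sum, h.compl1]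
    · obtain ⟨i, hi⟩ := Function.ne_iff.1 hv
      refine Finset.prod_eq_zero (Finset.mem_univ i) ?_
      rw [← Finset.mul_sum, h.compl _ _ hi, mul_zero]
  simp only [e]
  simp

lemma FB.orthn (h : FB p φ z) {n : ℕ} (s t : Fin n → ι) :
    exps p (fun v => ph φ s v * ph φ t v) = if s = t then 1 else 0 := by
  unfold ph
  simp only [← Finset.prod_mul_distrib]
  rw [exps_prod p (fun i a => φ (s i) a * φ (t i) a)]
  simp only [h.orth]
  split_ifs with hst
  · subst hst; simp
  · obtain ⟨i, hi⟩ := Function.ne_iff.1 hst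
    exact Finset.prod_eq_zero (Finset.mem_univ i) (by simp [hi])

lemma FB.parseval (h : FB p φ z) {n : ℕ} (c : (Fin n → ι) → ℝ) :
    exps p (fun v => (∑ s, c s * ph φ s v)^2) = ∑ s, c s ^ 2 := by
  have : ∀ v : Fin n → Ω, (∑ s, c s * ph φ s v)^2 =
      ∑ s, ∑ t, (c s * c t) * (ph φ s v * ph φ t v) := by
    intro v
    rw [sq, Finset.sum_mul_sum]
    exact Finset.sum_congr rfl fun s _ => Finset.sum_congr rfl fun t _ => by ring
  simp only [this, exps_sum, exps_mul_left, h.orthn]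
  simp [sq]

lemma FB.plancherel (h : FB p φ z) {n : ℕ} (f : (Fin n → Ω) → ℝ) :
    exps p (fun v => f v ^ 2) = ∑ s, hat p φ f s ^ 2 := by
  rw [← h.parseval (hat p φ f)]
  congr 1; funext v
  rw [← h.inversion f v]

lemma FB.mean (h : FB p φ z) (a : ι) : ∑ x, p x * φ a x = if a = z then 1 else 0 := by
  rw [← h.orth a z]
  simp [h.one]

open Classical in
/-- Noise kernel. -/
noncomputable def Nk (p : Ω → ℝ) (ρ : ℝ) (x a : Ω) : ℝ := (if x = a then ρ else 0) + (1 - ρ) * p a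

lemma Nk_apply (ρ : ℝ) (x : Ω) (f : Ω → ℝ) :
    ∑ a, Nk p ρ x a * f a = ρ * f x + (1 - ρ) * ∑ a, p a * f a := by
  classical
  unfold Nk
  simp only [add_mul, Finset.sum_add_distrib, ite_mul, zero_mul, Finset.sum_ite_eq,
    Finset.mem_univ, if_true, mul_assoc, ← Finset.mul_sum]

lemma FB.Nk_ph (h : FB p φ z) (ρ : ℝ) {n : ℕ} (s : Fin n → ι) (x : Fin n → Ω) :
    Kn (Nk p ρ) (ph φ s) x = ρ ^ dg z s * ph φ s x := by
  unfold ph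
  rw [Kn_prod (Nk p ρ) (fun i a => φ (s i) a)]
  simp only [Nk_apply, h.mean]
  unfold dg
  rw [← Finset.prod_const, Finset.prod_filter, ← Finset.prod_mul_distrib]
  refine Finset.prod_congr rfl fun i _ => ?_
  by_cases hi : s i = z
  · simp [hi, h.one]
  · simp [hi]

lemma FB.Nk_series (h : FB p φ z) (ρ : ℝ) {n : ℕ} (c : (Fin n → ι) → ℝ) (x : Fin n → Ω) :
    Kn (Nk p ρ) (fun v => ∑ s, c s * ph φ s v) x = ∑ s, (c s * ρ ^ dg z s) * ph φ s x := by
  rw [Kn_sum]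
  exact Finset.sum_congr rfl fun s _ => by rw [h.Nk_ph]; ring

lemma FB.Nk_f (h : FB p φ z) (ρ : ℝ) {n : ℕ} (f : (Fin n → Ω) → ℝ) (x : Fin n → Ω) :
    Kn (Nk p ρ) f x = ∑ s, (hat p φ f s * ρ ^ dg z s) * ph φ s x := by
  rw [← h.Nk_series]
  congr 1; funext v; exact h.inversion f v

lemma ph_update {n : ℕ} (s : Fin n → ι) (v : Fin n → Ω) (i : Fin n) (a : Ω) :
    ph φ s (Function.update v i a) = φ (s i) a * ∏ k ∈ Finset.univ.erase i, φ (s k) (v k) := by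
  unfold ph
  rw [← Finset.mul_prod_erase _ _ (Finset.mem_univ i), Function.update_self]
  congr 1
  refine Finset.prod_congr rfl fun k hk => ?_
  rw [Function.update_of_ne (Finset.ne_of_mem_erase hk)]

lemma FB.D_ph (h : FB p φ z) {n : ℕ} (s : Fin n → ι) (v : Fin n → Ω) (i : Fin n) :
    ph φ s v - ∑ a, p a * ph φ s (Function.update v i a) =
      if s i = z then 0 else ph φ s v := by
  simp only [ph_update, ← mul_assoc, ← Finset.sum_mul, h.mean]
  split_ifs with hi
  · unfold ph
    rw [← Finset.mul_prod_erase _ _ (Finset.mem_univ i), hi, h.one]; simp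
  · simp

lemma FB.D_series (h : FB p φ z) {n : ℕ} (c : (Fin n → ι) → ℝ) (v : Fin n → Ω) (i : Fin n) :
    (∑ s, c s * ph φ s v) - ∑ a, p a * ∑ s, c s * ph φ s (Function.update v i a) =
      ∑ s, (if s i = z then 0 else c s) * ph φ s v := by
  simp only [Finset.mul_sum]
  rw [Finset.sum_comm, ← Finset.sum_sub_distrib]
  refine Finset.sum_congr rfl fun s _ => ?_
  have := h.D_ph s v i
  have e : ∑ a, p a * (c s * ph φ s (Function.update v i a)) =
    c s * ∑ a, p a * ph φ s (Function.update v i a) := by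
    rw [Finset.mul_sum]; exact Finset.sum_congr rfl fun a _ => by ring
  rw [e, ← mul_sub, this]
  split_ifs <;> simp

lemma FB.D_f (h : FB p φ z) {n : ℕ} (f : (Fin n → Ω) → ℝ) (v : Fin n → Ω) (i : Fin n) :
    f v - ∑ a, p a * f (Function.update v i a) =
      ∑ s, (if s i = z then 0 else hat p φ f s) * ph φ s v := by
  rw [← h.D_series, ← h.inversion f v]
  simp only [← h.inversion f]

lemma FB.inf_eq (h : FB p φ z) {n : ℕ} (f : (Fin n → Ω) → ℝ) (i : Fin n) :
    exps p (fun v => (f v - ∑ a, p a * f (Function.update v i a))^2) =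
      ∑ s, if s i = z then 0 else hat p φ f s ^ 2 := by
  simp only [h.D_f, h.parseval]
  exact Finset.sum_congr rfl fun s _ => by split_ifs <;> simp

end fourier

/-! ### Contraction and hypercontractivity -/

lemma contraction {Ω W : Type} [Fintype Ω] [Fintype W] {K : W → Ω → ℝ} {ν : W → ℝ} {p : Ω → ℝ}
    {r : ℝ} (h : Ker K ν p r) (n : ℕ) : ∀ f : (Fin n → Ω) → ℝ,
    exps ν (fun w => (Kn K f w)^2) ≤ exps p (fun x => (Kn (Nk p r) f x)^2) := by
  induction n with
  | zero => intro f; rw [exps_zero, exps_zero, Kn_zero, Kn_zero]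
  | succ n ih =>
    intro f
    have hpn : ∀ a, 0 ≤ p a := fun a => (h.ppos a).le
    rw [exps_succ, exps_succ]
    simp only [Kn_succ']
    calc _ ≤ ∑ w, ν w * exps p (fun x => (Kn (Nk p r)
            (fun v => ∑ a, K w a * f (Fin.cons a v)) x)^2) :=
          Finset.sum_le_sum fun w _ => mul_le_mul_of_nonneg_left (ih _) (h.νnn w)
      _ ≤ _ := by
        simp only [Kn_sum, ← exps_mul_left]
        rw [← exps_sum, ← exps_sum]
        refine exps_mono hpn fun x => ?_
        simp only [Nk_apply]
        generalize hH : (fun a => Kn (Nk p r) (fun v => f (Fin.cons a v)) x) = H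
        have hH' : ∀ a, Kn (Nk p r) (fun v => f (Fin.cons a v)) x = H a := fun a => congrFun hH a
        simp only [hH']
        set M := ∑ a, p a * H a with hM
        have hmean : ∑ a, p a * (H a - M) = 0 := by
          simp only [mul_sub, Finset.sum_sub_distrib, ← Finset.sum_mul, h.p1, one_mul]; simp [hM]
        have g1 := h.gap _ hmean
        have g2 : ∀ w, ∑ a, K w a * (H a - M) = ∑ a, K w a * H a - M := by
          intro w
          simp only [mul_sub, Finset.sum_sub_distrib, ← Finset.sum_mul, h.K1 w, one_mul]
        simp only [g2] at g1
        have g3 := h.stf H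
        have g4 : ∑ w, ν w * (∑ a, K w a * H a)^2 =
            ∑ w, ν w * (∑ a, K w a * H a - M)^2 + M^2 := by
          have : ∀ w, ν w * (∑ a, K w a * H a)^2 = ν w * (∑ a, K w a * H a - M)^2 +
            2 * M * (ν w * ∑ a, K w a * H a) - ν w * M^2 := fun w => by ring
          simp only [this, Finset.sum_add_distrib, Finset.sum_sub_distrib, ← Finset.mul_sum,
            ← Finset.sum_mul, h.ν1, g3, ← hM]
          ring
        have g5 : ∑ a, p a * (r * H a + (1 - r) * M)^2 =
            r^2 * ∑ a, p a * (H a - M)^2 + M^2 := by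
          have : ∀ a, p a * (r * H a + (1 - r) * M)^2 = r^2 * (p a * (H a - M)^2) +
            2 * M * r * (p a * (H a - M)) + p a * M^2 := fun w => by ring
          simp only [this, Finset.sum_add_distrib, ← Finset.mul_sum,
            ← Finset.sum_mul, h.p1, hmean]
          ring
        rw [g4, g5]; linarith

lemma hyper_single {Ω : Type} [Fintype Ω] {p : Ω → ℝ} {pm : ℝ} (hpm0 : 0 < pm)
    (hpm : ∀ a, pm ≤ p a) (p1 : ∑ a, p a = 1) (H : Ω → ℝ) :
    ∑ x, p x * (∑ a, Nk p (pm/2) x a * H a)^4 ≤ (∑ a, p a * H a ^ 2)^2 := by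
  have hpn : ∀ a, 0 ≤ p a := fun a => hpm0.le.trans (hpm a)
  simp only [Nk_apply]
  set M := ∑ a, p a * H a with hM
  set S := ∑ a, p a * (H a - M)^2 with hS
  have hS0 : 0 ≤ S := Finset.sum_nonneg fun a _ => mul_nonneg (hpn a) (sq_nonneg _)
  have hmean : ∑ a, p a * (H a - M) = 0 := by
    simp only [mul_sub, Finset.sum_sub_distrib, ← Finset.sum_mul, p1, one_mul]; simp [hM]
  have e : ∑ a, p a * H a ^ 2 = S + M^2 := by
    have : ∀ a, p a * H a ^ 2 = p a * (H a - M)^2 + 2 * M * (p a * (H a - M)) + p a * M^2 :=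
      fun a => by ring
    simp only [this, Finset.sum_add_distrib, ← Finset.mul_sum, ← Finset.sum_mul, p1, hmean, hS]
    ring
  rw [e]
  by_cases hne : Nonempty Ω
  swap
  · rw [not_nonempty_iff] at hne
    simp at p1
  have hpm1 : pm ≤ 1 := by
    obtain ⟨a⟩ := hne
    rw [← p1]
    exact (hpm a).trans (Finset.single_le_sum (fun b _ => hpn b) (Finset.mem_univ a))
  set q := pm/2 with hq
  have hk : ∀ a, pm * (H a - M)^2 ≤ S := fun a =>
    (mul_le_mul_of_nonneg_right (hpm a) (sq_nonneg _)).trans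
      (Finset.single_le_sum (f := fun a => p a * (H a - M)^2)
        (fun b _ => mul_nonneg (hpn b) (sq_nonneg _)) (Finset.mem_univ a))
  have key : ∀ a, p a * (q * H a + (1 - q) * M)^4 ≤ p a * M^4 + 4 * M^3 * q * (p a * (H a - M)) +
      2 * M^2 * (p a * (H a - M)^2) + S * (p a * (H a - M)^2) := by
    intro a
    have hka := hk a
    set k := H a - M with hkk
    have e2 : q * H a + (1 - q) * M = M + q * k := by rw [hkk]; ring
    rw [e2]
    have : (M + q * k)^4 ≤ M^4 + 4 * M^3 * q * k + 2 * M^2 * k^2 + S * k^2 := by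
      have a1 : (M + q * k)^4 = M^4 + 4 * M^3 * q * k + 6 * (M^2 * (q * k)^2) +
        4 * (M * (q*k)) * (q*k)^2 + (q*k)^4 := by ring
      have a2 : 4 * (M * (q*k)) * (q*k)^2 ≤ 2 * (M^2 * (q*k)^2) + 2 * (q*k)^4 := by
        nlinarith [sq_nonneg (M * (q*k) - (q*k)^2)]
      have a3 : 8 * (M^2 * (q*k)^2) ≤ 2 * M^2 * k^2 := by
        have : q^2 ≤ 1/4 := by rw [hq]; nlinarith
        have h0 : 0 ≤ M^2 * k^2 := by positivity
        have : M^2 * (q*k)^2 = q^2 * (M^2*k^2) := by ring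
        nlinarith
      have a4 : 3 * (q*k)^4 ≤ S * k^2 := by
        have b1 : 3 * (q*k)^4 = (3/16 * pm^3) * (pm * k^2) * k^2 := by rw [hq]; ring
        have b2 : 3/16 * pm^3 ≤ 1 := by
          have : pm^3 ≤ 1 := pow_le_one₀ hpm0.le hpm1
          linarith
        rw [b1]
        have b3 : 0 ≤ pm * k^2 := by positivity
        have : (3/16 * pm^3) * (pm * k^2) ≤ S := by nlinarith
        exact mul_le_mul_of_nonneg_right this (sq_nonneg _)
      linarith
    have := mul_le_mul_of_nonneg_left this (hpn a)
    linarith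
  calc _ ≤ _ := Finset.sum_le_sum fun a _ => key a
    _ = M^4 + 2 * M^2 * S + S * S := by
      simp only [Finset.sum_add_distrib, ← Finset.mul_sum, ← Finset.sum_mul, p1, hmean, ← hS]
      ring
    _ ≤ _ := by nlinarith

lemma hyper {Ω : Type} [Fintype Ω] {p : Ω → ℝ} {pm : ℝ} (hpm0 : 0 < pm)
    (hpm : ∀ a, pm ≤ p a) (p1 : ∑ a, p a = 1) (n : ℕ) : ∀ f : (Fin n → Ω) → ℝ,
    exps p (fun x => (Kn (Nk p (pm/2)) f x)^4) ≤ (exps p (fun x => f x ^ 2))^2 := by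
  have hpn : ∀ a, 0 ≤ p a := fun a => hpm0.le.trans (hpm a)
  induction n with
  | zero => intro f; rw [exps_zero, exps_zero, Kn_zero]; exact le_of_eq (by ring)
  | succ n ih =>
    intro f
    rw [exps_succ, exps_succ]
    simp only [Kn_succ]
    set h : Ω → (Fin n → Ω) → ℝ := fun a x => Kn (Nk p (pm/2)) (fun v => f (Fin.cons a v)) x with hh
    set A : Ω → ℝ := fun a => exps p (fun x => f (Fin.cons a x) ^ 2) with hA
    have hA0 : ∀ a, 0 ≤ A a := fun a => exps_nonneg hpn fun x => sq_nonneg _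
    have key : ∀ a b, exps p (fun x => h a x ^ 2 * h b x ^ 2) ≤ A a * A b := by
      intro a b
      have c1 := exps_cs hpn (fun x => h a x ^ 2) (fun x => h b x ^ 2)
      have c2 : ∀ a, exps p (fun x => (h a x ^ 2)^2) ≤ A a ^ 2 := by
        intro a
        have := ih (fun v => f (Fin.cons a v))
        refine le_trans (le_of_eq ?_) this
        congr 1; funext x; simp only [hh]; ring
      refine abs_le_of_sq_le_sq' ?_ (mul_nonneg (hA0 a) (hA0 b)) |>.2
      rw [mul_pow]
      exact c1.trans (mul_le_mul (c2 a) (c2 b) (exps_nonneg hpn fun x => sq_nonneg _) (sq_nonneg _))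
    calc _ = exps p (fun x => ∑ y, p y * (∑ a, Nk p (pm/2) y a * h a x)^4) := by
          rw [exps_sum]; simp only [exps_mul_left, hh]
      _ ≤ exps p (fun x => (∑ a, p a * h a x ^ 2)^2) :=
          exps_mono hpn fun x => hyper_single hpm0 hpm p1 _
      _ = ∑ a, ∑ b, p a * p b * exps p (fun x => h a x ^ 2 * h b x ^ 2) := by
          have : ∀ x, (∑ a, p a * h a x ^ 2)^2 =
              ∑ a, ∑ b, (p a * p b) * (h a x ^ 2 * h b x ^ 2) := by
            intro x; rw [sq, Finset.sum_mul_sum]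
            exact Finset.sum_congr rfl fun s _ => Finset.sum_congr rfl fun t _ => by ring
          simp only [this, exps_sum, exps_mul_left]
      _ ≤ ∑ a, ∑ b, p a * p b * (A a * A b) :=
          Finset.sum_le_sum fun a _ => Finset.sum_le_sum fun b _ =>
            mul_le_mul_of_nonneg_left (key a b) (mul_nonneg (hpn a) (hpn b))
      _ = _ := by
          rw [sq, Finset.sum_mul_sum]
          exact Finset.sum_congr rfl fun s _ => Finset.sum_congr rfl fun t _ => by ring

lemma k_mul_pow_le {q : ℝ} (h0 : 0 ≤ q) (h1 : q < 1) (k : ℕ) : k * q ^ k ≤ 1 / (1 - q) := by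
  have e : (k:ℝ) * q ^ k ≤ ∑ j ∈ Finset.range k, q ^ j := by
    calc (k:ℝ) * q^k = ∑ j ∈ Finset.range k, q ^ k := by simp
      _ ≤ _ := Finset.sum_le_sum fun j hj =>
        pow_le_pow_of_le_one h0 h1.le (Finset.mem_range.1 hj).le
  refine e.trans ?_
  have h2 : 0 < 1 - q := by linarith
  rw [le_div_iff₀ h2]
  have := geom_sum_mul_neg q k
  rw [this]
  have := pow_nonneg h0 k
  linarith

lemma exps_sq_le_one {Ω : Type} [Fintype Ω] {n : ℕ} {p : Ω → ℝ} (hp : ∀ a, 0 ≤ p a)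
    (p1 : ∑ a, p a = 1) {g : (Fin n → Ω) → ℝ} (hg : ∀ v, g v ∈ Set.Icc (0:ℝ) 1) :
    exps p (fun v => g v ^ 2) ≤ 1 := by
  rw [← exps_const (n := n) p1 1]
  refine exps_mono hp fun v => ?_
  have := hg v
  nlinarith [this.1, this.2]

lemma noise_close {Ω W ι : Type} [Fintype Ω] [Fintype W] [Fintype ι] [DecidableEq ι]
    {K : W → Ω → ℝ} {ν : W → ℝ} {p : Ω → ℝ}
    {r : ℝ} (h : Ker K ν p r) {φ : ι → Ω → ℝ} {z : ι} (hF : FB p φ z) {n : ℕ}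
    {g : (Fin n → Ω) → ℝ} (hg : ∀ v, g v ∈ Set.Icc (0:ℝ) 1) {η : ℝ} (h0 : 0 ≤ η) (h1 : η ≤ 1) :
    exps ν (fun w => (Kn K g w - Kn K (Kn (Nk p (1-η)) g) w)^2) ≤ (η/(1-r))^2 := by
  have hpn : ∀ a, 0 ≤ p a := fun a => (h.ppos a).le
  have hr := h.r1
  have hr0 := h.r0
  have e1 : ∀ w, Kn K g w - Kn K (Kn (Nk p (1-η)) g) w =
      Kn K (fun v => ∑ s, (hat p φ g s * (1 - (1-η)^dg z s)) * ph φ s v) w := by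
    intro w
    rw [← Kn_sub]
    congr 1; funext v
    rw [hF.Nk_f, hF.inversion g v, ← Finset.sum_sub_distrib]
    exact Finset.sum_congr rfl fun s _ => by ring
  simp only [e1]
  refine (contraction h n _).trans ?_
  simp only [hF.Nk_series, hF.parseval]
  have e2 : ∀ s : Fin n → ι, (hat p φ g s * (1 - (1-η)^dg z s) * r ^ dg z s)^2 ≤
      (η/(1-r))^2 * hat p φ g s ^ 2 := by
    intro s
    set k := dg z s
    have b1 : 1 - (1-η)^k ≤ k * η := by
      have := one_add_mul_le_pow (a := -η) (by linarith) k
      have e : (1 - η)^k = (1 + -η)^k := by ring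
      rw [e]; linarith
    have b0 : 0 ≤ 1 - (1-η)^k := by
      have : (1-η)^k ≤ 1 := pow_le_one₀ (by linarith) (by linarith)
      linarith
    have b2 := k_mul_pow_le h.r0 h.r1 k
    have b3 : (1 - (1-η)^k) * r^k ≤ η/(1-r) := by
      calc _ ≤ (k*η) * r^k := mul_le_mul_of_nonneg_right b1 (pow_nonneg hr0 k)
        _ = η * (k * r^k) := by ring
        _ ≤ η * (1/(1-r)) := mul_le_mul_of_nonneg_left b2 h0
        _ = _ := by ring
    have b4 : ((1 - (1-η)^k) * r^k)^2 ≤ (η/(1-r))^2 :=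
      pow_le_pow_left₀ (mul_nonneg b0 (pow_nonneg hr0 k)) b3 2
    calc _ = ((1 - (1-η)^k) * r^k)^2 * hat p φ g s ^ 2 := by ring
      _ ≤ _ := mul_le_mul_of_nonneg_right b4 (sq_nonneg _)
  calc _ ≤ ∑ s, (η/(1-r))^2 * hat p φ g s ^ 2 := Finset.sum_le_sum fun s _ => e2 s
    _ = (η/(1-r))^2 * exps p (fun v => g v ^ 2) := by rw [← Finset.mul_sum, ← hF.plancherel]
    _ ≤ (η/(1-r))^2 * 1 := mul_le_mul_of_nonneg_left (exps_sq_le_one hpn h.p1 hg) (sq_nonneg _)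
    _ = _ := mul_one _

lemma Nk_nonneg {Ω : Type} {p : Ω → ℝ} (hp : ∀ a, 0 ≤ p a) {q : ℝ} (h0 : 0 ≤ q) (h1 : q ≤ 1)
    (x a : Ω) : 0 ≤ Nk p q x a := by
  unfold Nk
  have := mul_nonneg (sub_nonneg.2 h1) (hp a)
  split_ifs <;> linarith

lemma Nk_sum {Ω : Type} [Fintype Ω] {p : Ω → ℝ} (p1 : ∑ a, p a = 1) (q : ℝ)
    (x : Ω) : ∑ a, Nk p q x a = 1 := by
  have := Nk_apply (p := p) q x (fun _ => 1)
  simp only [mul_one, p1] at this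
  rw [this]; ring

lemma Nk_st {Ω : Type} [Fintype Ω] {p : Ω → ℝ} (p1 : ∑ a, p a = 1) (q : ℝ)
    (a : Ω) : ∑ x, p x * Nk p q x a = p a := by
  classical
  unfold Nk
  simp only [mul_add, Finset.sum_add_distrib, ← Finset.sum_mul, p1, mul_ite, mul_zero,
    Finset.sum_ite_eq', Finset.mem_univ, if_true]
  ring

lemma sum_deg_swap {ι : Type} [Fintype ι] [DecidableEq ι] (z : ι) {n : ℕ} (c : (Fin n → ι) → ℝ) :
    ∑ i : Fin n, ∑ s : Fin n → ι, (if s i = z then 0 else c s) = ∑ s, dg z s * c s := by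
  rw [Finset.sum_comm]
  refine Finset.sum_congr rfl fun s _ => ?_
  unfold dg
  have : ∀ i, (if s i = z then (0:ℝ) else c s) = if s i ≠ z then c s else 0 := by
    intro i; by_cases hi : s i = z <;> simp [hi]
  simp only [this]
  rw [← Finset.sum_filter, Finset.sum_const, nsmul_eq_mul]

lemma fourth_split {a b : ℝ} (h : |a + b| ≤ 1) : (a+b)^4 ≤ 16 * a^4 + 4 * b^2 := by
  by_cases hab : |b| ≤ |a|
  · have h1 : |a+b| ≤ 2 * |a| := (abs_add_le a b).trans (by linarith)
    have h2 : |a+b|^4 ≤ (2*|a|)^4 := by gcongr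
    have h3 : |a+b|^4 = (a+b)^4 := by rw [pow_abs]; exact abs_of_nonneg (by positivity)
    have h4 : |a|^4 = a^4 := by rw [pow_abs]; exact abs_of_nonneg (by positivity)
    rw [h3, mul_pow, h4] at h2
    nlinarith [sq_nonneg b]
  · have h1 : |a+b| ≤ 2 * |b| := (abs_add_le a b).trans (by linarith)
    have h2 : |a+b|^2 ≤ (2*|b|)^2 := by gcongr
    rw [sq_abs, mul_pow, sq_abs] at h2
    have h3 : (a+b)^2 ≤ 1 := by rw [← sq_abs]; exact pow_le_one₀ (abs_nonneg _) h
    have h5 : (a+b)^4 = (a+b)^2 * (a+b)^2 := by ring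
    have h6 : 0 ≤ a^4 := by positivity
    nlinarith [sq_nonneg (a+b)]

lemma Qf_noise_le {Ω ι : Type} [Fintype Ω] [Fintype ι] [DecidableEq ι]
    {p : Ω → ℝ} {pm : ℝ} (hpm0 : 0 < pm)
    (hpm : ∀ a, pm ≤ p a) (p1 : ∑ a, p a = 1) {φ : ι → Ω → ℝ} {z : ι} (hF : FB p φ z) {n : ℕ}
    {g : (Fin n → Ω) → ℝ} (hg : ∀ v, g v ∈ Set.Icc (0:ℝ) 1) {η : ℝ} (h0 : 0 < η) (h1 : η ≤ 1)
    {τ : ℝ} (hτ0 : 0 ≤ τ)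
    (hτ : ∀ i, exps p (fun v => (g v - ∑ a, p a * g (Function.update v i a))^2) ≤ τ) (d : ℕ) :
    Qf p (Kn (Nk p (1-η)) g) ≤ (16 * ((2/pm)^d)^4 * τ + 4 * (1-η)^d) / η := by
  have hpn : ∀ a, 0 ≤ p a := fun a => hpm0.le.trans (hpm a)
  set q := 1 - η with hq
  have hq0 : 0 ≤ q := by linarith
  have hq1 : q < 1 := by linarith
  have hu : ∀ x, Kn (Nk p q) g x ∈ Set.Icc (0:ℝ) 1 := fun x =>
    Kn_mem (Nk_nonneg hpn hq0 hq1.le) (Nk_sum p1 q) hg x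
  set c : (Fin n → ι) → ℝ := fun s => hat p φ g s * q ^ dg z s with hc
  have hbas : ∑ s, hat p φ g s ^ 2 ≤ 1 := by
    rw [← hF.plancherel]; exact exps_sq_le_one hpn p1 hg
  -- pieces
  set ca : Fin n → (Fin n → ι) → ℝ := fun i s =>
    if s i = z then 0 else if dg z s ≤ d then c s else 0 with hca
  set cb : Fin n → (Fin n → ι) → ℝ := fun i s =>
    if s i = z then 0 else if dg z s ≤ d then 0 else c s with hcb
  have hD : ∀ i v, Kn (Nk p q) g v - ∑ a, p a * Kn (Nk p q) g (Function.update v i a) =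
      ∑ s, ca i s * ph φ s v + ∑ s, cb i s * ph φ s v := by
    intro i v
    simp only [hF.Nk_f]
    rw [hF.D_series, ← Finset.sum_add_distrib]
    refine Finset.sum_congr rfl fun s _ => ?_
    simp only [hca, hcb, hc]
    split_ifs <;> ring
  have hle1 : ∀ i v, |∑ s, ca i s * ph φ s v + ∑ s, cb i s * ph φ s v| ≤ 1 := by
    intro i v
    rw [← hD]
    have a1 := hu v
    have a2 : ∑ a, p a * Kn (Nk p q) g (Function.update v i a) ≤ 1 := by
      calc _ ≤ ∑ a, p a * 1 := Finset.sum_le_sum fun a _ =>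
            mul_le_mul_of_nonneg_left (hu _).2 (hpn a)
        _ = 1 := by simp [p1]
    have a3 : 0 ≤ ∑ a, p a * Kn (Nk p q) g (Function.update v i a) :=
      Finset.sum_nonneg fun a _ => mul_nonneg (hpn a) (hu _).1
    rw [abs_le]
    constructor <;> linarith [a1.1, a1.2]
  set I : Fin n → ℝ := fun i => ∑ s : Fin n → ι, (if s i = z then 0 else c s ^ 2) with hI
  have hI0 : ∀ i, 0 ≤ I i := fun i => Finset.sum_nonneg fun s _ => by split_ifs <;> positivity
  have hqk : ∀ k : ℕ, (q^k)^2 ≤ q^k := by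
    intro k
    have a := pow_nonneg hq0 k
    have b : q^k ≤ 1 := pow_le_one₀ hq0 hq1.le
    nlinarith
  have hkq : ∀ k : ℕ, (k:ℝ) * q^k ≤ 1/η := by
    intro k
    have := k_mul_pow_le hq0 hq1 k
    rwa [hq, sub_sub_cancel] at this
  have hIτ : ∀ i, I i ≤ τ := by
    intro i
    refine le_trans ?_ (hτ i)
    rw [hF.inf_eq]
    refine Finset.sum_le_sum fun s _ => ?_
    split_ifs
    · exact le_rfl
    · simp only [hc]
      rw [mul_pow]
      have b : (q^dg z s)^2 ≤ 1 := (hqk _).trans (pow_le_one₀ hq0 hq1.le)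
      nlinarith [sq_nonneg (hat p φ g s)]
  have hIsum : ∑ i, I i ≤ 1/η := by
    simp only [hI]
    rw [sum_deg_swap]
    calc _ ≤ ∑ s : Fin n → ι, (1/η) * hat p φ g s ^ 2 := by
          refine Finset.sum_le_sum fun s _ => ?_
          simp only [hc]
          calc (dg z s : ℝ) * (hat p φ g s * q^dg z s)^2
                = (dg z s : ℝ) * (q^dg z s)^2 * hat p φ g s ^2 := by ring
            _ ≤ (dg z s : ℝ) * (q^dg z s) * hat p φ g s ^2 := by
                gcongr; exact hqk _
            _ ≤ _ := mul_le_mul_of_nonneg_right (hkq _) (sq_nonneg _)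
      _ ≤ (1/η) * 1 := by
          rw [← Finset.mul_sum]
          exact mul_le_mul_of_nonneg_left hbas (by positivity)
      _ = _ := mul_one _
  -- low part
  have hlow : ∀ i, exps p (fun v => (∑ s, ca i s * ph φ s v)^4) ≤ ((2/pm)^d)^4 * (τ * I i) := by
    intro i
    have e : ∀ v, ∑ s, ca i s * ph φ s v = Kn (Nk p (pm/2))
        (fun v => ∑ s, (ca i s * (2/pm)^dg z s) * ph φ s v) v := by
      intro v
      rw [hF.Nk_series]
      refine Finset.sum_congr rfl fun s _ => ?_
      have : (2/pm)^dg z s * (pm/2)^dg z s = 1 := by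
        rw [← mul_pow, div_mul_div_comm, mul_comm 2 pm, div_self (by positivity), one_pow]
      rw [mul_assoc (ca i s), this, mul_one]
    simp only [e]
    refine (hyper hpm0 hpm p1 n _).trans ?_
    rw [hF.parseval]
    have hpm1 : pm ≤ 1 := by
      by_cases hne : Nonempty Ω
      · obtain ⟨a⟩ := hne
        rw [← p1]
        exact (hpm a).trans (Finset.single_le_sum (fun b _ => hpn b) (Finset.mem_univ a))
      · rw [not_nonempty_iff] at hne; simp at p1
    have h2pm : 1 ≤ 2/pm := by rw [le_div_iff₀ hpm0]; linarith
    have s1 : ∑ s, (ca i s * (2/pm)^dg z s)^2 ≤ ((2/pm)^d)^2 * I i := by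
      simp only [hI]; rw [Finset.mul_sum]
      refine Finset.sum_le_sum fun s _ => ?_
      simp only [hca]
      split_ifs with i1 i2
      · simp
      · rw [mul_pow, mul_comm]
        have : (2/pm)^dg z s ≤ (2/pm)^d := pow_le_pow_right₀ h2pm i2
        gcongr
      · simp; positivity
    calc _ ≤ (((2/pm)^d)^2 * I i)^2 :=
          pow_le_pow_left₀ (Finset.sum_nonneg fun s _ => sq_nonneg _) s1 2
      _ = ((2/pm)^d)^4 * (I i * I i) := by ring
      _ ≤ _ := by
          have := hI0 i
          gcongr
          exact hIτ i
  have hhigh : ∑ i, exps p (fun v => (∑ s, cb i s * ph φ s v)^2) ≤ q^d / η := by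
    simp only [hF.parseval]
    have e : ∀ i s, cb i s ^2 = if s i = z then 0 else (if dg z s ≤ d then 0 else c s ^2) := by
      intro i s; simp only [hcb]; split_ifs <;> simp
    simp only [e]
    rw [sum_deg_swap]
    calc _ ≤ ∑ s : Fin n → ι, (q^d/η) * hat p φ g s ^ 2 := by
          refine Finset.sum_le_sum fun s _ => ?_
          split_ifs with hs
          · simp; positivity
          · simp only [hc]
            have b1 : q^dg z s ≤ q^d := pow_le_pow_of_le_one hq0 hq1.le (by omega)
            have b2 := hkq (dg z s)
            have b3 : (dg z s:ℝ) * (q^dg z s)^2 ≤ q^d/η := by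
              calc (dg z s:ℝ) * (q^dg z s)^2 = ((dg z s:ℝ) * q^dg z s) * q^dg z s := by ring
                _ ≤ (1/η) * q^d := mul_le_mul b2 b1 (pow_nonneg hq0 _) (by positivity)
                _ = _ := by ring
            calc _ = (dg z s:ℝ) * (q^dg z s)^2 * hat p φ g s ^2 := by ring
              _ ≤ _ := mul_le_mul_of_nonneg_right b3 (sq_nonneg _)
      _ ≤ (q^d/η) * 1 := by
          rw [← Finset.mul_sum]
          exact mul_le_mul_of_nonneg_left hbas (by positivity)
      _ = _ := mul_one _
  unfold Qf
  simp only [hD]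
  calc _ ≤ ∑ i, (16 * exps p (fun v => (∑ s, ca i s * ph φ s v)^4) +
          4 * exps p (fun v => (∑ s, cb i s * ph φ s v)^2)) := by
        refine Finset.sum_le_sum fun i _ => ?_
        rw [← exps_mul_left, ← exps_mul_left, ← exps_add]
        exact exps_mono hpn fun v => fourth_split (hle1 i v)
    _ ≤ ∑ i, (16 * (((2/pm)^d)^4 * (τ * I i)) +
          4 * exps p (fun v => (∑ s, cb i s * ph φ s v)^2)) :=
        Finset.sum_le_sum fun i _ => by linarith [hlow i]
    _ = (16 * ((2/pm)^d)^4 * τ) * ∑ i, I i +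
          4 * ∑ i, exps p (fun v => (∑ s, cb i s * ph φ s v)^2) := by
        rw [Finset.sum_add_distrib, Finset.mul_sum, Finset.mul_sum]
        congr 1
        exact Finset.sum_congr rfl fun i _ => by ring
    _ ≤ (16 * ((2/pm)^d)^4 * τ) * (1/η) + 4 * (q^d/η) := by
        have : 0 ≤ 16 * ((2/pm)^d)^4 * τ := by positivity
        gcongr
    _ = _ := by ring

/-! ### The small-ball lemma -/

lemma core_small_ball {Ω W : Type} [Fintype Ω] [Fintype W]
    {K : W → Ω → ℝ} {ν : W → ℝ} {p : Ω → ℝ}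
    {r : ℝ} (h : Ker K ν p r) {pm : ℝ} (hpm0 : 0 < pm) (hpm : ∀ a, pm ≤ p a) {n : ℕ}
    {u : (Fin n → Ω) → ℝ} (hu : ∀ v, u v ∈ Set.Icc (0:ℝ) 1) {α ε L : ℝ} (hα0 : 0 < α)
    (hα : α ≤ exps p u) (hε : 0 < ε) (hL1 : 1 ≤ L) (hL2 : 2 * Real.log (2/α) ≤ L)
    (hL3 : 256 * (16/(1-r^2)) / (α * ε) ≤ L)
    (hQ : cJump r (Real.exp (-(2*L))) pm * Qf p u ≤ 1) :
    exps ν (fun w => if Kn K u w + Real.exp (-(2*L)) < Real.exp (-L) then (1:ℝ) else 0) ≤ ε/2 := by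
  have hpn : ∀ a, 0 ≤ p a := fun a => (h.ppos a).le
  set κ := Real.exp (-(2*L)) with hκ
  have hκ0 : 0 < κ := Real.exp_pos _
  have hκ1 : κ ≤ 1 := Real.exp_le_one_iff.2 (by linarith)
  set C := 16/(1-r^2) with hC
  have hr2 : 0 < 1 - r^2 := by nlinarith [h.r0, h.r1]
  have hC1 : 1 ≤ C := by
    rw [hC, le_div_iff₀ hr2]; nlinarith [sq_nonneg r]
  obtain ⟨V, B, E, h1, h2, h3, h4, h5⟩ := induction_lemma h hpm0 hpm hκ0 hκ1 n u hu
  have hKu : ∀ w, Kn K u w ∈ Set.Icc (0:ℝ) 1 := fun w => Kn_mem h.Knn h.K1 hu w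
  have hV : V ≤ C * (2*L+2) := by
    have a1 : exps ν (fun w => Real.log (Kn K u w + κ)) ≤ 1 := by
      rw [← exps_const (n := n) h.ν1 1]
      refine exps_mono h.νnn fun w => ?_
      have b := hKu w
      have := Real.log_le_sub_one_of_pos (x := Kn K u w + κ) (by linarith [b.1])
      linarith [b.2]
    have a2 : -(2*L) ≤ exps p (fun x => Real.log (u x + κ)) := by
      rw [← exps_const (n := n) h.p1 (-(2*L))]
      refine exps_mono hpn fun x => ?_
      rw [Real.le_log_iff_exp_le (by linarith [(hu x).1])]
      linarith [(hu x).1]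
    have a3 : C * (exps ν (fun w => Real.log (Kn K u w + κ)) - exps p (fun x => Real.log (u x + κ)))
        ≤ C * (2*L+1) := mul_le_mul_of_nonneg_left (by linarith) (by linarith)
    linarith
  set l := Real.log (2/α) with hl
  have hα1 : α ≤ 1 := hα.trans (by
    rw [← exps_const (n := n) h.p1 1]; exact exps_mono hpn fun x => (hu x).2)
  have hl0 : 0 ≤ l := Real.log_nonneg (by rw [le_div_iff₀ hα0]; linarith)
  set bad : (Fin n → W) → ℝ := fun w => if Kn K u w + κ < Real.exp (-L) then (1:ℝ) else 0 with hbad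
  set good : (Fin n → Ω) → ℝ := fun x => if α/2 ≤ u x then (1:ℝ) else 0 with hgood
  have hgoodp : α/2 ≤ exps p good := by
    have : exps p u ≤ exps p (fun x => α/2 + good x) := by
      refine exps_mono hpn fun x => ?_
      simp only [hgood]
      split_ifs with hx
      · linarith [(hu x).2]
      · push Not at hx; linarith
    rw [exps_add, exps_const h.p1] at this
    linarith
  have hbad0 : 0 ≤ exps ν bad := exps_nonneg h.νnn fun w => by simp only [hbad]; split_ifs <;> simp
  have hpt : ∀ w x, bad w * (good x * (L-l)^2) ≤ 2 * (B w x)^2 + 2 * (E w x)^2 := by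
    intro w x
    simp only [hbad, hgood]
    split_ifs with hw hx
    · have a1 := h1 w x
      have a2 : Real.log (Kn K u w + κ) < -L := by
        rw [Real.log_lt_iff_lt_exp (by linarith [(hKu w).1])]; exact hw
      have a3 : -l ≤ Real.log (u x + κ) := by
        rw [hl, ← Real.log_inv, inv_div]
        exact Real.log_le_log (by positivity) (by linarith)
      have a4 : L - l ≤ -(B w x + E w x) := by linarith
      have a5 : 0 ≤ L - l := by linarith
      nlinarith [sq_nonneg (B w x - E w x)]
    · simp; positivity
    · simp; positivity
    · simp; positivity
  have hprod4 : exps ν bad * (exps p good * (L-l)^2) ≤ 4 * V := by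
    calc _ = exps ν (fun w => exps p (fun x => bad w * (good x * (L-l)^2))) := by
          simp only [exps_mul_left, exps_mul_right]
      _ ≤ exps ν (fun w => exps p (fun x => 2 * (B w x)^2 + 2 * (E w x)^2)) :=
          exps_mono h.νnn fun w => exps_mono hpn fun x => hpt w x
      _ ≤ _ := by
          simp only [exps_add, exps_mul_left]; linarith
  have hLl : L/2 ≤ L - l := by linarith
  have hsq : L^2/4 ≤ (L-l)^2 := by nlinarith
  have k1 : exps ν bad * (α/2 * (L^2/4)) ≤ 4 * (C * (2*L+2)) := by
    refine le_trans (mul_le_mul_of_nonneg_left ?_ hbad0) (hprod4.trans (by linarith))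
    exact mul_le_mul hgoodp hsq (by positivity) (by linarith)
  rw [div_le_iff₀ (by positivity)] at hL3
  -- bad * α L^2 / 8 ≤ 8 C (L+1) ≤ 16 C L
  have k2 : exps ν bad * (α * L) ≤ 128 * C := by
    have : (exps ν bad * (α * L)) * L ≤ (128 * C) * L := by nlinarith
    exact le_of_mul_le_mul_right this (by linarith)
  have k3 : exps ν bad * (α * L) ≤ (ε/2) * (α * L) := by nlinarith
  exact le_of_mul_le_mul_right k3 (by positivity)

set_option maxHeartbeats 2000000 in
lemma small_ball {Ω W ι : Type} [Fintype Ω] [Fintype W] [Fintype ι] [DecidableEq ι]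
    {K : W → Ω → ℝ} {ν : W → ℝ} {p : Ω → ℝ}
    {r : ℝ} (h : Ker K ν p r) {pm : ℝ} (hpm0 : 0 < pm) (hpm : ∀ a, pm ≤ p a) (z : ι)
    {α ε : ℝ} (hα0 : 0 < α) (hε : 0 < ε) :
    ∃ κ : ℝ, 0 < κ ∧ ∃ τ : ℝ, 0 < τ ∧ ∀ (n : ℕ) (φ : ι → Ω → ℝ), FB p φ z →
      ∀ g : (Fin n → Ω) → ℝ, (∀ v, g v ∈ Set.Icc (0:ℝ) 1) → α ≤ exps p g →
      (∀ i, exps p (fun v => (g v - ∑ a, p a * g (Function.update v i a))^2) ≤ τ) →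
      exps ν (fun w => if Kn K g w < κ then (1:ℝ) else 0) ≤ ε := by
  have hpn : ∀ a, 0 ≤ p a := fun a => (h.ppos a).le
  obtain ⟨L, hL⟩ : ∃ L : ℝ, L = max 1 (max (2 * Real.log (2/α)) (256 * (16/(1-r^2)) / (α * ε))) :=
    ⟨_, rfl⟩
  have hL1 : 1 ≤ L := by rw [hL]; exact le_max_left _ _
  have hL2 : 2 * Real.log (2/α) ≤ L := by
    rw [hL]; exact (le_max_left _ _).trans (le_max_right _ _)
  have hL3 : 256 * (16/(1-r^2)) / (α * ε) ≤ L := by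
    rw [hL]; exact (le_max_right _ _).trans (le_max_right _ _)
  have hexp : Real.exp (-L) ≤ 1/2 := by
    have : Real.exp (-L) ≤ Real.exp (-1) := Real.exp_le_exp.2 (by linarith)
    have h2 : Real.exp (-1) ≤ 1/2 := by
      rw [Real.exp_neg, inv_le_comm₀ (Real.exp_pos _) (by norm_num)]
      have := Real.add_one_le_exp (1:ℝ)
      norm_num at *; linarith
    linarith
  have hexp0 := Real.exp_pos (-L)
  have hexp2 : Real.exp (-(2*L)) = Real.exp (-L) * Real.exp (-L) := by
    rw [← Real.exp_add]; congr 1; ring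
  set κ := Real.exp (-L) / 4 with hκ
  have hκ0 : 0 < κ := by positivity
  have hr := h.r1
  have hr0 := h.r0
  set t := min ε 1 with ht
  have ht0 : 0 < t := lt_min hε one_pos
  have ht1 : t ≤ 1 := min_le_right _ _
  have htε : t ≤ ε := min_le_left _ _
  set η := (1-r) * κ * t / 2 with hη
  have h1r : 0 < 1 - r := by linarith
  have hη0 : 0 < η := by positivity
  have hη1 : η < 1 := by
    have a1 : κ ≤ 1 := by linarith
    have a2 : (1-r) * κ ≤ 1 := by nlinarith
    have a3 : (1-r) * κ * t ≤ 1 := by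
      have : 0 ≤ (1-r) * κ := by positivity
      nlinarith
    linarith
  set cJ := cJump r (Real.exp (-(2*L))) pm with hcJ
  have hcJ0 : 0 ≤ cJ := cJump_nonneg hpm0
  obtain ⟨d, hd⟩ := exists_pow_lt_of_lt_one (show 0 < η / (8 * (cJ+1)) by positivity)
    (show 1 - η < 1 by linarith)
  set τ := η / (32 * (cJ+1) * ((2/pm)^d)^4) with hτ
  have hτ0 : 0 < τ := by positivity
  refine ⟨κ, hκ0, τ, hτ0, ?_⟩
  intro n φ hF g hg hgα hinf
  have hq0 : 0 ≤ 1 - η := by linarith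
  have hQ := Qf_noise_le hpm0 hpm h.p1 hF hg hη0 hη1.le hτ0.le hinf d
  set u := Kn (Nk p (1-η)) g with hu
  have hum : ∀ v, u v ∈ Set.Icc (0:ℝ) 1 := fun x =>
    Kn_mem (Nk_nonneg hpn hq0 (by linarith)) (Nk_sum h.p1 _) hg x
  have huα : α ≤ exps p u := by
    rw [hu, exps_Kn (Nk_st h.p1 (1-η))]; exact hgα
  have hQ1 : cJ * Qf p u ≤ 1 := by
    have b1 : 16 * ((2/pm)^d)^4 * τ = η / (2 * (cJ+1)) := by
      rw [hτ]; field_simp; norm_num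
    have b2 : (16 * ((2/pm)^d)^4 * τ + 4 * (1-η)^d) / η ≤ 1 / (cJ+1) := by
      rw [div_le_iff₀ hη0, b1]
      have : 4 * (η / (8 * (cJ+1))) = η / (2*(cJ+1)) := by field_simp; norm_num
      have e : 1/(cJ+1) * η = η / (2*(cJ+1)) + η / (2*(cJ+1)) := by field_simp; norm_num
      rw [e]; linarith
    calc cJ * Qf p u ≤ cJ * (1/(cJ+1)) := mul_le_mul_of_nonneg_left (hQ.trans b2) hcJ0
      _ ≤ 1 := by rw [mul_one_div, div_le_one (by linarith)]; linarith
  have hcore := core_small_ball h hpm0 hpm hum hα0 huα hε hL1 hL2 hL3 hQ1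
  have hclose := noise_close h hF hg hη0.le hη1.le
  rw [← hu] at hclose
  have hpt : ∀ w, (if Kn K g w < κ then (1:ℝ) else 0) ≤
      (if Kn K u w + Real.exp (-(2*L)) < Real.exp (-L) then (1:ℝ) else 0) +
      (1/κ^2) * (Kn K g w - Kn K u w)^2 := by
    intro w
    have hnn : 0 ≤ (1/κ^2) * (Kn K g w - Kn K u w)^2 := by positivity
    split_ifs with c1 c2 c2
    · linarith
    · push Not at c2
      rw [hexp2] at c2
      have d1 : 2 * κ ≤ Kn K u w := by rw [hκ]; nlinarith
      have d2 : κ ≤ Kn K u w - Kn K g w := by linarith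
      have d3 : κ^2 ≤ (Kn K g w - Kn K u w)^2 := by nlinarith
      rw [one_div, inv_mul_eq_div]
      have : 1 ≤ (Kn K g w - Kn K u w)^2 / κ^2 := by rw [le_div_iff₀ (by positivity)]; linarith
      linarith
    · linarith
    · linarith
  calc _ ≤ _ := exps_mono h.νnn hpt
    _ ≤ ε/2 + (1/κ^2) * (η/(1-r))^2 := by
        rw [exps_add, exps_mul_left]
        have : 0 ≤ 1/κ^2 := by positivity
        gcongr
    _ ≤ ε := by
        have : (1/κ^2) * (η/(1-r))^2 = t^2/4 := by
          rw [hη]; field_simp; norm_num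
        rw [this]; nlinarith

/-! ### The conditional kernel of a multi-step distribution -/

open Classical in
/-- Conditional law of coordinate `j` given the others. -/
noncomputable def Kj {Ω : Type} [Fintype Ω] {ℓ : ℕ} (P : (Fin ℓ → Ω) → ℝ) (j : Fin ℓ)
    (t : Fin ℓ → Ω) (a : Ω) : ℝ :=
  if ∑ b, P (Function.update t j b) = 0 then marginal P j a
  else P (Function.update t j a) / ∑ b, P (Function.update t j b)

section kernel
variable {Ω : Type} [Fintype Ω] {ℓ : ℕ} {P : (Fin ℓ → Ω) → ℝ}

lemma marg_sum (P : (Fin ℓ → Ω) → ℝ) (j : Fin ℓ) (H : Ω → ℝ) :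
    ∑ t, P t * H (t j) = ∑ a, marginal P j a * H a := by
  classical
  unfold marginal
  simp only [Finset.sum_mul]
  rw [Finset.sum_comm]
  refine Finset.sum_congr rfl fun t _ => ?_
  simp [ite_mul]

lemma marg_one (hP : IsDist P) (j : Fin ℓ) : ∑ a, marginal P j a = 1 := by
  have := marg_sum P j (fun _ => 1)
  simp only [mul_one] at this
  rw [← this, hP.2]

lemma marg_nonneg (hP : IsDist P) (j : Fin ℓ) (a : Ω) : 0 ≤ marginal P j a := by
  unfold marginal
  exact Finset.sum_nonneg fun t _ => by split_ifs; exacts [hP.1 t, le_rfl]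

lemma Kj_nonneg (hP : IsDist P) (j : Fin ℓ) (t : Fin ℓ → Ω) (a : Ω) : 0 ≤ Kj P j t a := by
  unfold Kj
  split_ifs
  · exact marg_nonneg hP j a
  · exact div_nonneg (hP.1 _) (Finset.sum_nonneg fun b _ => hP.1 _)

lemma Kj_one (hP : IsDist P) (j : Fin ℓ) (t : Fin ℓ → Ω) : ∑ a, Kj P j t a = 1 := by
  unfold Kj
  split_ifs with h
  · exact marg_one hP j
  · rw [← Finset.sum_div, div_self h]

lemma Kj_update (j : Fin ℓ) (t : Fin ℓ → Ω) (b a : Ω) :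
    Kj P j (Function.update t j b) a = Kj P j t a := by
  unfold Kj
  simp only [Function.update_idem]

lemma Kj_pos (hP : IsDist P) (j : Fin ℓ) (t : Fin ℓ → Ω) (a : Ω) (ht : 0 < P t)
    (h : 0 < Kj P j t a) : 0 < P (Function.update t j a) := by
  unfold Kj at h
  split_ifs at h with h0
  · exfalso
    rw [Finset.sum_eq_zero_iff_of_nonneg (fun b _ => hP.1 _)] at h0
    have := h0 (t j) (Finset.mem_univ _)
    rw [Function.update_eq_self] at this
    linarith
  · by_contra hc
    have : P (Function.update t j a) = 0 := le_antisymm (not_lt.1 hc) (hP.1 _)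
    rw [this, zero_div] at h
    exact lt_irrefl _ h

/-- Swap involution. -/
def swapEquiv (Ω : Type) {ℓ : ℕ} (j : Fin ℓ) : ((Fin ℓ → Ω) × Ω) ≃ ((Fin ℓ → Ω) × Ω) where
  toFun x := (Function.update x.1 j x.2, x.1 j)
  invFun x := (Function.update x.1 j x.2, x.1 j)
  left_inv x := by simp
  right_inv x := by simp

lemma cond_id (hP : IsDist P) (j : Fin ℓ) (Φ : (Fin ℓ → Ω) → ℝ) (H : Ω → ℝ)
    (hΦ : ∀ t a, Φ (Function.update t j a) = Φ t) :
    ∑ t, P t * (Φ t * H (t j)) = ∑ t, P t * (Φ t * ∑ a, Kj P j t a * H a) := by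
  have e1 : ∑ t, P t * (Φ t * ∑ a, Kj P j t a * H a) =
      ∑ x : (Fin ℓ → Ω) × Ω, P x.1 * (Φ x.1 * (Kj P j x.1 x.2 * H x.2)) := by
    rw [Fintype.sum_prod_type]
    exact Finset.sum_congr rfl fun t _ => by simp only [Finset.mul_sum]
  rw [e1, ← (swapEquiv Ω j).sum_comp, Fintype.sum_prod_type]
  refine Finset.sum_congr rfl fun t _ => ?_
  simp only [swapEquiv, Equiv.coe_fn_mk, hΦ, Kj_update]
  rw [← Finset.sum_mul]
  have e2 : (∑ b, P (Function.update t j b)) * Kj P j t (t j) = P t := by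
    unfold Kj
    split_ifs with h0
    · rw [h0, zero_mul]
      rw [Finset.sum_eq_zero_iff_of_nonneg (fun b _ => hP.1 _)] at h0
      have := h0 (t j) (Finset.mem_univ _)
      rw [Function.update_eq_self] at this
      exact this.symm
    · rw [Function.update_eq_self]; field_simp
  calc _ = ((∑ b, P (Function.update t j b)) * Kj P j t (t j)) * (Φ t * H (t j)) := by rw [e2]
    _ = _ := by ring

lemma Kj_stf (hP : IsDist P) (j : Fin ℓ) (H : Ω → ℝ) :
    ∑ t, P t * ∑ a, Kj P j t a * H a = ∑ a, marginal P j a * H a := by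
  have := cond_id hP j (fun _ => 1) H (fun _ _ => rfl)
  simp only [one_mul] at this
  rw [← this, marg_sum]

lemma Kj_st (hP : IsDist P) (j : Fin ℓ) (a : Ω) :
    ∑ t, P t * Kj P j t a = marginal P j a := by
  classical
  have := Kj_stf hP j (fun b => if b = a then 1 else 0)
  simpa using this

lemma varP_nonneg (hP : IsDist P) (f : (Fin ℓ → Ω) → ℝ) : 0 ≤ varP P f := by
  unfold varP covP
  set M := expP P f with hM
  have : expP P (fun x => f x * f x) - M * M = ∑ x, P x * (f x - M)^2 := by
    have e : ∀ x, P x * (f x - M)^2 = P x * (f x * f x) - 2 * M * (P x * f x) + P x * (M * M) :=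
      fun x => by ring
    simp only [e, Finset.sum_add_distrib, Finset.sum_sub_distrib, ← Finset.mul_sum,
      ← Finset.sum_mul, hP.2]
    have : ∑ x, P x * f x = M := rfl
    rw [this]; unfold expP; ring
  rw [this]
  exact Finset.sum_nonneg fun x _ => mul_nonneg (hP.1 x) (sq_nonneg _)

lemma covP_le (hP : IsDist P) (f g : (Fin ℓ → Ω) → ℝ) (hf : varP P f = 1) (hg : varP P g = 1) :
    covP P f g ≤ 1 := by
  have h := varP_nonneg hP (fun x => f x - g x)
  have e : varP P (fun x => f x - g x) = varP P f + varP P g - 2 * covP P f g := by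
    unfold varP covP
    have e1 : expP P (fun x => f x - g x) = expP P f - expP P g := by
      unfold expP; simp only [mul_sub, Finset.sum_sub_distrib]
    have e2 : expP P (fun x => (f x - g x) * (f x - g x)) = expP P (fun x => f x * f x)
        + expP P (fun x => g x * g x) - 2 * expP P (fun x => f x * g x) := by
      unfold expP
      rw [Finset.mul_sum, ← Finset.sum_add_distrib, ← Finset.sum_sub_distrib]
      exact Finset.sum_congr rfl fun x _ => by ring
    rw [e1, e2]; ring
  rw [e, hf, hg] at h
  linarith

lemma le_rho (hP : IsDist P) (j : Fin ℓ) (f g : (Fin ℓ → Ω) → ℝ) (h1 : DependsOn f {j})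
    (h2 : DependsOn g ({j}ᶜ)) (hf : varP P f = 1) (hg : varP P g = 1) :
    covP P f g ≤ rho P := by
  have a : covP P f g ≤ rhoST P {j} ({j}ᶜ) := by
    unfold rhoST
    refine le_csSup ⟨1, ?_⟩ ⟨f, g, h1, h2, hf, hg, rfl⟩
    rintro _ ⟨f, g, _, _, hf, hg, rfl⟩
    exact covP_le hP f g hf hg
  refine a.trans ?_
  unfold rho
  exact le_ciSup (f := fun j => rhoST P {j} ({j}ᶜ)) (Set.finite_range _).bddAbove j

lemma Kj_gap (hP : IsDist P) (j : Fin ℓ) {r : ℝ} (hr0 : 0 ≤ r) (hr : rho P ≤ r) (f : Ω → ℝ)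
    (hf : ∑ a, marginal P j a * f a = 0) :
    ∑ t, P t * (∑ a, Kj P j t a * f a)^2 ≤ r^2 * ∑ a, marginal P j a * f a ^ 2 := by
  set G : (Fin ℓ → Ω) → ℝ := fun t => ∑ a, Kj P j t a * f a with hG
  set F : (Fin ℓ → Ω) → ℝ := fun t => f (t j) with hF
  set A := ∑ a, marginal P j a * f a ^ 2 with hA
  set B := ∑ t, P t * G t ^ 2 with hB
  have hA0 : 0 ≤ A := Finset.sum_nonneg fun a _ => mul_nonneg (marg_nonneg hP j a) (sq_nonneg _)
  have hB0 : 0 ≤ B := Finset.sum_nonneg fun a _ => mul_nonneg (hP.1 a) (sq_nonneg _)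
  have hGup : ∀ t a, G (Function.update t j a) = G t := by
    intro t a; simp only [hG, Kj_update]
  have eA : ∑ t, P t * (F t * F t) = A := by
    rw [hA, ← marg_sum P j (fun a => f a ^ 2)]
    exact Finset.sum_congr rfl fun t _ => by simp only [hF]; ring
  have eFG : ∑ t, P t * (F t * G t) = B := by
    have := cond_id hP j G f hGup
    rw [hB]
    calc _ = ∑ t, P t * (G t * f (t j)) := Finset.sum_congr rfl fun t _ => by simp only [hF]; ring
      _ = _ := by rw [this]; exact Finset.sum_congr rfl fun t _ => by simp only [hG]; ring
  have mF : ∑ t, P t * F t = 0 := by rw [← hf, ← marg_sum]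
  have mG : ∑ t, P t * G t = 0 := by rw [← hf]; exact Kj_stf hP j f
  by_cases hBz : B = 0
  · rw [hBz]; positivity
  have hBp : 0 < B := lt_of_le_of_ne hB0 (Ne.symm hBz)
  have hCS : B^2 ≤ A * B := by
    rw [← eFG]
    nth_rewrite 2 [eFG]
    rw [← eA, hB]
    refine Finset.sum_sq_le_sum_mul_sum_of_sq_le_mul _ ?_ ?_ ?_
    · exact fun t _ => mul_nonneg (hP.1 t) (mul_self_nonneg _)
    · exact fun t _ => mul_nonneg (hP.1 t) (sq_nonneg _)
    · intro t _; exact le_of_eq (by ring)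
  have hAp : 0 < A := by
    by_contra hc
    have : A = 0 := le_antisymm (not_lt.1 hc) hA0
    rw [this, zero_mul] at hCS
    nlinarith
  have hsA := Real.sqrt_pos.2 hAp
  have hsB := Real.sqrt_pos.2 hBp
  have qA := Real.mul_self_sqrt hA0
  have qB := Real.mul_self_sqrt hB0
  set sA := Real.sqrt A
  set sB := Real.sqrt B
  have key := le_rho hP j (fun t => (1/sA) * F t) (fun t => (1/sB) * G t) ?_ ?_ ?_ ?_
  · have e : covP P (fun t => (1/sA) * F t) (fun t => (1/sB) * G t) = sB / sA := by
      unfold covP expP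
      have e1 : ∑ t, P t * ((1/sA) * F t) = (1/sA) * ∑ t, P t * F t := by
        rw [Finset.mul_sum]; exact Finset.sum_congr rfl fun t _ => by ring
      have e2 : ∑ t, P t * (((1/sA) * F t) * ((1/sB) * G t)) =
          (1/sA) * (1/sB) * ∑ t, P t * (F t * G t) := by
        rw [Finset.mul_sum]; exact Finset.sum_congr rfl fun t _ => by ring
      rw [e1, e2, mF, eFG, ← qB]; field_simp; ring
    rw [e, div_le_iff₀ hsA] at key
    have : sB ≤ r * sA := key.trans (mul_le_mul_of_nonneg_right hr hsA.le)
    rw [← qA, ← qB]; nlinarith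
  · intro x y hxy
    simp only [hF]; rw [hxy j (by simp)]
  · intro x y hxy
    have : x = Function.update y j (x j) := by
      funext k
      by_cases hk : k = j
      · subst hk; simp
      · rw [Function.update_of_ne hk]; exact hxy k (by simp [hk])
    simp only
    rw [this, hGup]
  · unfold varP covP expP
    have e1 : ∑ t, P t * ((1/sA) * F t) = (1/sA) * ∑ t, P t * F t := by
      rw [Finset.mul_sum]; exact Finset.sum_congr rfl fun t _ => by ring
    have e2 : ∑ t, P t * (((1/sA) * F t) * ((1/sA) * F t)) =
        (1/sA) * (1/sA) * ∑ t, P t * (F t * F t) := by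
      rw [Finset.mul_sum]; exact Finset.sum_congr rfl fun t _ => by ring
    rw [e1, e2, mF, eA, ← qA]; field_simp; ring
  · unfold varP covP expP
    have e1 : ∑ t, P t * ((1/sB) * G t) = (1/sB) * ∑ t, P t * G t := by
      rw [Finset.mul_sum]; exact Finset.sum_congr rfl fun t _ => by ring
    have e2 : ∑ t, P t * (((1/sB) * G t) * ((1/sB) * G t)) =
        (1/sB) * (1/sB) * B := by
      rw [hB, Finset.mul_sum]; exact Finset.sum_congr rfl fun t _ => by ring
    rw [e1, e2, mG, ← qB]; field_simp; ring

lemma Kj_ker (hP : IsDist P) (hsupp : ∀ (j : Fin ℓ) (a : Ω), 0 < marginal P j a) {r : ℝ}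
    (hr0 : 0 ≤ r) (hr : rho P ≤ r) (hr1 : r < 1) (j : Fin ℓ) :
    Ker (Kj P j) P (marginal P j) r where
  Knn := Kj_nonneg hP j
  K1 := Kj_one hP j
  νnn := hP.1
  ν1 := hP.2
  ppos := hsupp j
  p1 := marg_one hP j
  st := Kj_st hP j
  r0 := hr0
  r1 := hr1
  gap := Kj_gap hP j hr0 hr

lemma cons_col {n : ℕ} (t : Fin ℓ → Ω) (vs : Fin n → Fin ℓ → Ω) (j : Fin ℓ) :
    (fun i => (Fin.cons t vs : Fin (n+1) → Fin ℓ → Ω) i j) = Fin.cons (t j) (fun i => vs i j) := by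
  funext i
  refine Fin.cases ?_ (fun i => ?_) i <;> simp

lemma cond_n (hP : IsDist P) (j : Fin ℓ) (n : ℕ) :
    ∀ (Φ : (Fin n → Fin ℓ → Ω) → ℝ) (h : (Fin n → Ω) → ℝ),
    (∀ v v' : Fin n → Fin ℓ → Ω, (∀ i k, k ≠ j → v i k = v' i k) → Φ v = Φ v') →
    exps P (fun v => Φ v * h (fun i => v i j)) = exps P (fun v => Φ v * Kn (Kj P j) h v) := by
  induction n with
  | zero =>
    intro Φ h _
    rw [exps_zero, exps_zero, Kn_zero, Subsingleton.elim (fun i : Fin 0 => (Fin.elim0 i : Fin ℓ → Ω) j) Fin.elim0]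
  | succ n ih =>
    intro Φ h hΦ
    rw [exps_succ, exps_succ]
    simp only [cons_col]
    have e : ∀ t : Fin ℓ → Ω, exps P (fun vs => Φ (Fin.cons t vs) *
        h (Fin.cons (t j) (fun i => vs i j))) = exps P (fun vs => Φ (Fin.cons t vs) *
        Kn (Kj P j) (fun x => h (Fin.cons (t j) x)) vs) := by
      intro t
      refine ih (fun vs => Φ (Fin.cons t vs)) (fun x => h (Fin.cons (t j) x)) ?_
      intro v v' hv
      refine hΦ _ _ fun i k hk => ?_
      refine Fin.cases ?_ (fun i => ?_) i
      · simp
      · simp [hv i k hk]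
    simp only [e, Kn_succ, ← exps_mul_left]
    rw [← exps_sum, ← exps_sum]
    congr 1; funext vs
    refine cond_id hP j (fun t => Φ (Fin.cons t vs))
      (fun a => Kn (Kj P j) (fun x => h (Fin.cons a x)) vs) ?_
    intro t a
    refine hΦ _ _ fun i k hk => ?_
    refine Fin.cases ?_ (fun i => ?_) i
    · simp [Function.update_of_ne hk]
    · simp

lemma exps_marg (P : (Fin ℓ → Ω) → ℝ) (j : Fin ℓ) (n : ℕ) : ∀ (h : (Fin n → Ω) → ℝ),
    exps P (fun v => h (fun i => v i j)) = exps (marginal P j) h := by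
  induction n with
  | zero =>
    intro h
    rw [exps_zero, exps_zero, Subsingleton.elim (fun i : Fin 0 => (Fin.elim0 i : Fin ℓ → Ω) j) Fin.elim0]
  | succ n ih =>
    intro h
    rw [exps_succ, exps_succ]
    simp only [cons_col]
    have e : ∀ t : Fin ℓ → Ω, exps P (fun vs => h (Fin.cons (t j) (fun i => vs i j))) =
      exps (marginal P j) (fun x => h (Fin.cons (t j) x)) := fun t =>
        ih (fun x => h (Fin.cons (t j) x))
    simp only [e]
    exact marg_sum P j (fun a => exps (marginal P j) (fun x => h (Fin.cons a x)))

lemma prodExp_eq {n : ℕ} (f : Fin ℓ → ((Fin n → Ω) → ℝ)) :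
    prodExp P f = exps P (fun v => ∏ j, f j (fun i => v i j)) := by
  unfold prodExp exps
  exact (Equiv.piComm (fun (_ : Fin ℓ) (_ : Fin n) => Ω)).sum_comp
    (fun v => (∏ i, P (v i)) * ∏ j, f j (fun i => v i j))

end kernel

/-! ### Outer induction over the steps -/

lemma outer_induction {Ω ι : Type} [Fintype Ω] [Fintype ι] [DecidableEq ι] {ℓ : ℕ}
    {P : (Fin ℓ → Ω) → ℝ} (hP : IsDist P) {r : ℝ}
    (hK : ∀ j, Ker (Kj P j) P (marginal P j) r) {pm : ℝ} (hpm0 : 0 < pm)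
    (hpm : ∀ j a, pm ≤ marginal P j a) (z : ι) {α : ℝ} (hα0 : 0 < α) (J : Finset (Fin ℓ)) :
    ∃ δ : ℝ, 0 < δ ∧ ∃ τ : ℝ, 0 < τ ∧ ∀ (n : ℕ) (φ : Fin ℓ → ι → Ω → ℝ),
      (∀ j, FB (marginal P j) (φ j) z) →
      ∀ g : Fin ℓ → (Fin n → Ω) → ℝ, (∀ j v, g j v ∈ Set.Icc (0:ℝ) 1) →
      (∀ j, α ≤ exps (marginal P j) (g j)) →
      (∀ j i, exps (marginal P j) (fun v =>
        (g j v - ∑ a, marginal P j a * g j (Function.update v i a))^2) ≤ τ) →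
      δ ≤ exps P (fun v => ∏ j ∈ J, g j (fun i => v i j)) := by
  induction J using Finset.induction_on with
  | empty =>
    refine ⟨1, one_pos, 1, one_pos, ?_⟩
    intro n φ _ g _ _ _
    simp only [Finset.prod_empty]
    rw [exps_const hP.2]
  | insert s J hs ih =>
    obtain ⟨δ, hδ, τ, hτ, H⟩ := ih
    obtain ⟨κ, hκ, τ', hτ', H'⟩ := small_ball (hK s) hpm0 (hpm s) z hα0 (half_pos hδ)
    refine ⟨κ * (δ/2), by positivity, min τ τ', lt_min hτ hτ', ?_⟩
    intro n φ hφ g hg hgα hinf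
    have a1 := H n φ hφ g hg hgα (fun j i => (hinf j i).trans (min_le_left _ _))
    have a2 := H' n (φ s) (hφ s) (g s) (hg s) (hgα s) (fun i => (hinf s i).trans (min_le_right _ _))
    have e : ∀ v : Fin n → Fin ℓ → Ω, ∏ j ∈ insert s J, g j (fun i => v i j) =
        (∏ j ∈ J, g j (fun i => v i j)) * g s (fun i => v i s) := by
      intro v; rw [Finset.prod_insert hs]; ring
    simp only [e]
    rw [cond_n hP s n (fun v => ∏ j ∈ J, g j (fun i => v i j)) (g s)]
    · calc κ * (δ/2) ≤ κ * (exps P (fun v => ∏ j ∈ J, g j (fun i => v i j)) -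
            exps P (fun w => if Kn (Kj P s) (g s) w < κ then (1:ℝ) else 0)) :=
            mul_le_mul_of_nonneg_left (by linarith) hκ.le
        _ = exps P (fun v => κ * ((∏ j ∈ J, g j (fun i => v i j)) -
            if Kn (Kj P s) (g s) v < κ then (1:ℝ) else 0)) := by
            rw [exps_mul_left, exps_sub]
        _ ≤ _ := by
            refine exps_mono hP.1 fun v => ?_
            have b0 : 0 ≤ ∏ j ∈ J, g j (fun i => v i j) :=
              Finset.prod_nonneg fun j _ => (hg j _).1
            have b1 : ∏ j ∈ J, g j (fun i => v i j) ≤ 1 :=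
              Finset.prod_le_one (fun j _ => (hg j _).1) fun j _ => (hg j _).2
            have b2 := (Kn_mem (hK s).Knn (hK s).K1 (hg s) v).1
            split_ifs with hc
            · have := mul_nonneg b0 b2
              nlinarith
            · push Not at hc
              nlinarith
    · intro v v' hv
      refine Finset.prod_congr rfl fun j hj => ?_
      congr 1; funext i
      exact hv i j (fun h => hs (h ▸ hj))

/-! ### Removing influential coordinates -/

lemma exists_weight {β : Type} [Fintype β] (w F : β → ℝ) (hw : ∀ b, 0 ≤ w b) (hw1 : ∑ b, w b = 1)
    {c : ℝ} (hc : c ≤ ∑ b, w b * F b) : ∃ b, 0 < w b ∧ c ≤ F b := by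
  by_contra hcon
  push Not at hcon
  have h1 : ∃ b ∈ Finset.univ, 0 < w b := by
    by_contra h
    push Not at h
    have : ∑ b, w b ≤ 0 := Finset.sum_nonpos h
    linarith
  obtain ⟨b, _, hb⟩ := h1
  have : ∑ b, w b * F b < ∑ b, w b * c := by
    refine Finset.sum_lt_sum (fun b _ => ?_) ⟨b, Finset.mem_univ _, ?_⟩
    · rcases (hw b).eq_or_lt with h0 | h0
      · rw [← h0]; simp
      · exact mul_le_mul_of_nonneg_left (hcon b h0).le (hw b)
    · exact mul_lt_mul_of_pos_left (hcon b hb) hb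
  rw [← Finset.sum_mul, hw1, one_mul] at this
  linarith

lemma exps_var_update {Ω : Type} [Fintype Ω] {n : ℕ} {p : Ω → ℝ} (hp : ∑ a, p a = 1) (i : Fin n)
    (g : (Fin n → Ω) → ℝ) :
    exps p (fun v => (g v - ∑ a, p a * g (Function.update v i a))^2) =
    exps p (fun v => ∑ a, p a * (g (Function.update v i a) -
      ∑ b, p b * g (Function.update v i b))^2) := by
  rw [← exps_update hp i]
  simp only [Function.update_idem]

/-- Gain of the maximum at one coordinate. -/
lemma max_gain {Ω : Type} [Fintype Ω] {ℓ : ℕ} {P : (Fin ℓ → Ω) → ℝ} (hP : IsDist P) {r : ℝ}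
    {j : Fin ℓ} (hK : Ker (Kj P j) P (marginal P j) r) (H : Ω → ℝ)
    (hH : ∀ a, H a ∈ Set.Icc (0:ℝ) 1) :
    (1 - r^2) * ∑ a, marginal P j a * (H a - ∑ b, marginal P j b * H b)^2 ≤
      ∑ t, ∑ z, P t * Kj P j t z * (max (H (t j)) (H z) - H (t j)) := by
  set M := ∑ b, marginal P j b * H b with hM
  set V := ∑ a, marginal P j a * (H a - M)^2 with hV
  have hmean : ∑ a, marginal P j a * (H a - M) = 0 := by
    simp only [mul_sub, Finset.sum_sub_distrib, ← Finset.sum_mul, hK.p1, one_mul]; simp [hM]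
  have hg := hK.gap _ hmean
  rw [← hV] at hg
  set G : (Fin ℓ → Ω) → ℝ := fun t => ∑ a, Kj P j t a * (H a - M) with hG
  have hpt : ∀ t z, P t * Kj P j t z * ((H z - M)/2 - (H (t j) - M)/2 + (H z - M)^2/2 +
      (H (t j) - M)^2/2 - (H (t j) - M) * (H z - M)) ≤
      P t * Kj P j t z * (max (H (t j)) (H z) - H (t j)) := by
    intro t z
    refine mul_le_mul_of_nonneg_left ?_ (mul_nonneg (hP.1 t) (hK.Knn t z))
    have a := hH (t j)
    have b := hH z
    rcases le_total (H (t j)) (H z) with h | h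
    · rw [max_eq_right h]; nlinarith [a.1, a.2, b.1, b.2]
    · rw [max_eq_left h]; nlinarith [a.1, a.2, b.1, b.2]
  refine le_trans ?_ (Finset.sum_le_sum fun t _ => Finset.sum_le_sum fun z _ => hpt t z)
  have inner : ∀ t, ∑ z, P t * Kj P j t z * ((H z - M)/2 - (H (t j) - M)/2 + (H z - M)^2/2 +
      (H (t j) - M)^2/2 - (H (t j) - M) * (H z - M)) =
      (1/2) * (P t * G t) - (1/2) * (P t * (H (t j) - M)) +
      (1/2) * (P t * ∑ z, Kj P j t z * (H z - M)^2) + (1/2) * (P t * (H (t j) - M)^2)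
      - P t * (G t * (H (t j) - M)) := by
    intro t
    have k1 := hK.K1 t
    have : ∀ z, P t * Kj P j t z * ((H z - M)/2 - (H (t j) - M)/2 + (H z - M)^2/2 +
      (H (t j) - M)^2/2 - (H (t j) - M) * (H z - M)) =
      (P t / 2 - P t * (H (t j) - M)) * (Kj P j t z * (H z - M)) +
      (P t / 2) * (Kj P j t z * (H z - M)^2) +
      Kj P j t z * (P t * (-(H (t j) - M)/2 + (H (t j) - M)^2/2)) := fun z => by ring
    simp only [this, Finset.sum_add_distrib, ← Finset.mul_sum, ← Finset.sum_mul, k1]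
    simp only [hG]; ring
  simp only [inner]
  simp only [Finset.sum_add_distrib, Finset.sum_sub_distrib, ← Finset.mul_sum]
  have e1 : ∑ t, P t * G t = 0 := by rw [← hmean]; exact Kj_stf hP j (fun a => H a - M)
  have e2 : ∑ t, P t * (H (t j) - M) = 0 := by
    rw [← hmean]; exact marg_sum P j (fun a => H a - M)
  have e3 : ∑ t, P t * ∑ z, Kj P j t z * (H z - M)^2 = V := Kj_stf hP j (fun a => (H a - M)^2)
  have e4 : ∑ t, P t * (H (t j) - M)^2 = V := marg_sum P j (fun a => (H a - M)^2)
  have e5 : ∑ t, P t * (G t * (H (t j) - M)) = ∑ t, P t * G t ^ 2 := by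
    rw [cond_id hP j G (fun a => H a - M) (fun t a => by simp only [hG, Kj_update])]
    exact Finset.sum_congr rfl fun t _ => by simp only [hG]; ring
  rw [e1, e2, e3, e4, e5]
  linarith

open Classical in
/-- One step of the removal of influential coordinates. -/
lemma removal_step {Ω : Type} [Fintype Ω] {ℓ : ℕ} {P : (Fin ℓ → Ω) → ℝ} (hP : IsDist P) {r : ℝ}
    (hK : ∀ j, Ker (Kj P j) P (marginal P j) r) {pmin : ℝ} (hpmin0 : 0 < pmin)
    (hpmin : ∀ t, 0 < P t → pmin ≤ P t) {n : ℕ} (g : Fin ℓ → (Fin n → Ω) → ℝ)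
    (hg : ∀ j v, g j v ∈ Set.Icc (0:ℝ) 1) {τ : ℝ} (j : Fin ℓ) (i : Fin n)
    (hτ : τ < exps (marginal P j) (fun v =>
        (g j v - ∑ a, marginal P j a * g j (Function.update v i a))^2)) :
    ∃ g' : Fin ℓ → (Fin n → Ω) → ℝ, (∀ j v, g' j v ∈ Set.Icc (0:ℝ) 1) ∧
      (∃ c : Fin ℓ → Ω, ∀ j' x, g j' (Function.update x i (c j')) ≤ g' j' x) ∧
      (∑ j', exps (marginal P j') (g j')) + (1-r^2)*τ ≤ ∑ j', exps (marginal P j') (g' j') ∧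
      pmin * prodExp P g' ≤ prodExp P g := by
  set G' : (Fin ℓ → Ω) → Ω → Fin ℓ → (Fin n → Ω) → ℝ := fun t z j' x =>
    if j' = j then max (g j (Function.update x i (t j))) (g j (Function.update x i z))
    else g j' (Function.update x i (t j')) with hG'
  have hr2 : 0 < 1 - r^2 := by nlinarith [(hK j).r0, (hK j).r1]
  -- average of potentials
  have havg : (∑ j', exps (marginal P j') (g j')) + (1-r^2)*τ ≤
      ∑ x : (Fin ℓ → Ω) × Ω, (P x.1 * Kj P j x.1 x.2) *
        ∑ j', exps (marginal P j') (G' x.1 x.2 j') := by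
    have e1 : ∀ t z, ∑ j', exps (marginal P j') (G' t z j') =
        (∑ j', exps (marginal P j') (fun x => g j' (Function.update x i (t j')))) +
        exps (marginal P j) (fun x => max (g j (Function.update x i (t j)))
          (g j (Function.update x i z)) - g j (Function.update x i (t j))) := by
      intro t z
      rw [exps_sub, ← Finset.add_sum_erase _ _ (Finset.mem_univ j),
        ← Finset.add_sum_erase (a := j) _ (fun j' => exps (marginal P j')
          (fun x => g j' (Function.update x i (t j')))) (Finset.mem_univ j)]
      have e2 : ∑ j' ∈ Finset.univ.erase j, exps (marginal P j') (G' t z j') =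
          ∑ j' ∈ Finset.univ.erase j, exps (marginal P j')
            (fun x => g j' (Function.update x i (t j'))) := by
        refine Finset.sum_congr rfl fun k hk => ?_
        congr 1; funext x
        simp only [hG', if_neg (Finset.ne_of_mem_erase hk)]
      have e3 : G' t z j = fun x => max (g j (Function.update x i (t j)))
          (g j (Function.update x i z)) := by funext x; simp [hG']
      rw [e2, e3]; ring
    rw [Fintype.sum_prod_type]
    simp only [e1, mul_add, Finset.sum_add_distrib]
    have f1 : ∑ t, ∑ z, P t * Kj P j t z * ∑ j', exps (marginal P j')
        (fun x => g j' (Function.update x i (t j'))) = ∑ j', exps (marginal P j') (g j') := by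
      simp only [mul_assoc, ← Finset.mul_sum, ← Finset.sum_mul, (hK j).K1, one_mul]
      simp only [Finset.mul_sum]
      rw [Finset.sum_comm]
      refine Finset.sum_congr rfl fun j' _ => ?_
      rw [marg_sum P j' (fun a => exps (marginal P j') (fun x => g j' (Function.update x i a)))]
      simp only [← exps_mul_left]
      rw [← exps_sum, exps_update (hK j').p1]
    have f2 : (1-r^2) * exps (marginal P j) (fun v =>
        (g j v - ∑ a, marginal P j a * g j (Function.update v i a))^2) ≤
        ∑ t, ∑ z, P t * Kj P j t z * exps (marginal P j) (fun x =>
          max (g j (Function.update x i (t j)))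
          (g j (Function.update x i z)) - g j (Function.update x i (t j))) := by
      rw [exps_var_update (hK j).p1]
      simp only [← exps_mul_left, ← exps_sum]
      refine exps_mono (fun a => ((hK j).ppos a).le) fun x => ?_
      exact max_gain hP (hK j) (fun a => g j (Function.update x i a)) (fun a => hg _ _)
    have f3 := mul_le_mul_of_nonneg_left hτ.le hr2.le
    linarith
  have hw1 : ∑ x : (Fin ℓ → Ω) × Ω, P x.1 * Kj P j x.1 x.2 = 1 := by
    rw [Fintype.sum_prod_type]
    simp only [← Finset.mul_sum, (hK j).K1, mul_one, hP.2]
  obtain ⟨⟨t, z⟩, hpos, hc⟩ := exists_weight _ _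
    (fun x : (Fin ℓ → Ω) × Ω => mul_nonneg (hP.1 x.1) ((hK j).Knn x.1 x.2)) hw1 havg
  simp only at hpos hc
  have hPt : 0 < P t := by
    rcases (hP.1 t).eq_or_lt with h0 | h0
    · rw [← h0, zero_mul] at hpos; exact absurd hpos (lt_irrefl _)
    · exact h0
  have hKt : 0 < Kj P j t z := by
    rcases ((hK j).Knn t z).eq_or_lt with h0 | h0
    · rw [← h0, mul_zero] at hpos; exact absurd hpos (lt_irrefl _)
    · exact h0
  have hPt' := Kj_pos hP j t z hPt hKt
  refine ⟨G' t z, ?_, ⟨t, ?_⟩, hc, ?_⟩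
  · intro j' v
    simp only [hG']
    split_ifs
    · exact ⟨le_max_of_le_left (hg _ _).1, max_le (hg _ _).2 (hg _ _).2⟩
    · exact hg _ _
  · intro j' x
    simp only [hG']
    split_ifs with h
    · subst h; exact le_max_left _ _
    · exact le_rfl
  · rw [prodExp_eq, prodExp_eq, ← exps_mul_left, ← exps_update hP.2 i (fun v => ∏ j, g j fun i => v i j)]
    refine exps_mono hP.1 fun v => ?_
    have hcol : ∀ (s : Fin ℓ → Ω) (j' : Fin ℓ), (fun k => Function.update v i s k j') =
        Function.update (fun k => v k j') i (s j') := by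
      intro s j'; funext k
      by_cases hk : k = i
      · subst hk; simp
      · simp [Function.update_of_ne hk]
    simp only [hcol]
    set A : (Fin ℓ → Ω) → ℝ := fun s => ∏ j', g j' (Function.update (fun k => v k j') i (s j')) with hA
    have hA0 : ∀ s, 0 ≤ A s := fun s => Finset.prod_nonneg fun j' _ => (hg _ _).1
    have hle : ∀ s, 0 < P s → pmin * A s ≤ ∑ s, P s * A s := by
      intro s hs
      exact (mul_le_mul_of_nonneg_right (hpmin s hs) (hA0 s)).trans
        (Finset.single_le_sum (f := fun s => P s * A s)
          (fun s _ => mul_nonneg (hP.1 s) (hA0 s)) (Finset.mem_univ s))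
    have hor : ∏ j', G' t z j' (fun k => v k j') = A t ∨
        ∏ j', G' t z j' (fun k => v k j') = A (Function.update t j z) := by
      rcases le_total (g j (Function.update (fun k => v k j) i z))
        (g j (Function.update (fun k => v k j) i (t j))) with h | h
      · left
        refine Finset.prod_congr rfl fun j' _ => ?_
        simp only [hG']
        split_ifs with hj
        · subst hj; exact max_eq_left h
        · rfl
      · right
        refine Finset.prod_congr rfl fun j' _ => ?_
        simp only [hG']
        split_ifs with hj
        · subst hj; rw [Function.update_self]; exact max_eq_right h
        · rw [Function.update_of_ne hj]
    rcases hor with h | h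
    · rw [h]; exact hle _ hPt
    · rw [h]; exact hle _ hPt'

/-- Overwrite the coordinates in `I` by `a`. -/
def ow {Ω : Type} {n : ℕ} (I : Finset (Fin n)) (a x : Fin n → Ω) : Fin n → Ω :=
  fun i => if i ∈ I then a i else x i

lemma removal {Ω : Type} [Fintype Ω] {ℓ : ℕ} {P : (Fin ℓ → Ω) → ℝ} (hP : IsDist P) {r : ℝ}
    (hK : ∀ j, Ker (Kj P j) P (marginal P j) r) {pmin : ℝ} (hpmin0 : 0 < pmin) (hpmin1 : pmin ≤ 1)
    (hpmin : ∀ t, 0 < P t → pmin ≤ P t) {n : ℕ} {τ : ℝ} [Nonempty Ω] (N : ℕ) :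
    ∀ (g : Fin ℓ → (Fin n → Ω) → ℝ), (∀ j v, g j v ∈ Set.Icc (0:ℝ) 1) →
    (ℓ : ℝ) - N * ((1-r^2)*τ) < ∑ j, exps (marginal P j) (g j) →
    ∃ g' : Fin ℓ → (Fin n → Ω) → ℝ, (∀ j v, g' j v ∈ Set.Icc (0:ℝ) 1) ∧
      (∃ I : Finset (Fin n), I.card ≤ N ∧ ∃ a : Fin ℓ → Fin n → Ω,
        ∀ j x, g j (ow I (a j) x) ≤ g' j x) ∧
      (∀ j i, exps (marginal P j) (fun v =>
        (g' j v - ∑ a, marginal P j a * g' j (Function.update v i a))^2) ≤ τ) ∧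
      pmin ^ N * prodExp P g' ≤ prodExp P g := by
  induction N with
  | zero =>
    intro g hg hlt
    exfalso
    have : ∑ j, exps (marginal P j) (g j) ≤ ∑ j : Fin ℓ, (1:ℝ) := by
      refine Finset.sum_le_sum fun j _ => ?_
      rw [← exps_const (n := n) (hK j).p1 1]
      exact exps_mono (fun a => ((hK j).ppos a).le) fun v => (hg j v).2
    simp at this hlt
    linarith
  | succ N ih =>
    intro g hg hlt
    by_cases hall : ∀ j i, exps (marginal P j) (fun v =>
        (g j v - ∑ a, marginal P j a * g j (Function.update v i a))^2) ≤ τ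
    · refine ⟨g, hg, ⟨∅, by simp, fun _ _ => Classical.arbitrary Ω, fun j x => ?_⟩, hall, ?_⟩
      · have : ow ∅ (fun _ => Classical.arbitrary Ω) x = x := by funext i; simp [ow]
        rw [this]
      · have h0 : 0 ≤ prodExp P g := by
          rw [prodExp_eq]
          exact exps_nonneg hP.1 fun v => Finset.prod_nonneg fun j _ => (hg _ _).1
        have h1 : pmin ^ (N+1) ≤ 1 := pow_le_one₀ hpmin0.le hpmin1
        nlinarith
    · push Not at hall
      obtain ⟨j, i, hji⟩ := hall
      obtain ⟨g1, hg1, ⟨c, hc⟩, hpot, hpr⟩ := removal_step hP hK hpmin0 hpmin g hg j i hji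
      obtain ⟨g', hg', ⟨I, hI, a, ha⟩, hinf, hpr'⟩ := ih g1 hg1 (by push_cast at hlt; linarith)
      refine ⟨g', hg', ⟨insert i I, ?_, fun j => Function.update (a j) i (c j), ?_⟩, hinf, ?_⟩
      · exact (Finset.card_insert_le _ _).trans (by omega)
      · intro j x
        refine le_trans (le_trans (le_of_eq ?_) (hc j (ow I (a j) x))) (ha j x)
        congr 1; funext k
        by_cases hk : k = i
        · subst hk; simp [ow]
        · simp [ow, Function.update_of_ne hk, hk]
      · calc pmin^(N+1) * prodExp P g' = pmin * (pmin^N * prodExp P g') := by ring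
          _ ≤ pmin * prodExp P g1 := mul_le_mul_of_nonneg_left hpr' hpmin0.le
          _ ≤ _ := hpr

/-! ### Small Fourier coefficients control restrictions -/

lemma FB_of_basis {Ω : Type} [Fintype Ω] {m : ℕ} (hcard : Fintype.card Ω = m)
    {p : Ω → ℝ} (hp : ∀ a, 0 < p a) (φ : Fin m → Ω → ℝ) (z : Fin m)
    (h1 : ∀ w, φ z w = 1)
    (h2 : ∀ a b, expPi p (fun w => φ a w * φ b w) = if a = b then 1 else 0) : FB p φ z := by
  classical
  let A : Matrix (Fin m) Ω ℝ := fun a x => φ a x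
  let B : Matrix Ω (Fin m) ℝ := fun x a => p x * φ a x
  have hAB : A * B = 1 := by
    ext a b
    rw [Matrix.mul_apply, Matrix.one_apply, ← h2 a b]
    unfold expPi
    exact Finset.sum_congr rfl fun x _ => by simp only [A, B]; ring
  have hBA : B * A = 1 := by
    have e : Fin m ≃ Ω := (Fintype.equivFinOfCardEq hcard).symm
    exact (Matrix.mul_eq_one_comm_of_equiv e).1 hAB
  have hcomp : ∀ x y, p x * ∑ a, φ a x * φ a y = if x = y then 1 else 0 := by
    intro x y
    have := congrFun (congrFun hBA x) y
    rw [Matrix.mul_apply, Matrix.one_apply] at this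
    rw [← this, Finset.mul_sum]
    exact Finset.sum_congr rfl fun a _ => by simp only [A, B]; ring
  refine ⟨h1, h2, ?_, ?_⟩
  · intro x y hxy
    have := hcomp x y
    rw [if_neg hxy] at this
    exact (mul_eq_zero.1 this).resolve_left (hp x).ne'
  · intro x
    have := hcomp x x
    rwa [if_pos rfl] at this

lemma restricted_mean {Ω : Type} [Fintype Ω] {m : ℕ} {p : Ω → ℝ} {φ : Fin m → Ω → ℝ} {z : Fin m}
    (hF : FB p φ z) {pm : ℝ} (hpm0 : 0 < pm) (hpm1 : pm ≤ 1) (hpm : ∀ a, pm ≤ p a) {n : ℕ}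
    (f : (Fin n → Ω) → ℝ) {k : ℕ} {γ : ℝ} (hγ0 : 0 ≤ γ)
    (hγ : ∀ s : Fin n → Fin m, 0 < dg z s → dg z s ≤ k → |hat p φ f s| ≤ γ)
    (I : Finset (Fin n)) (hI : I.card ≤ k) (a : Fin n → Ω) :
    exps p f - γ * (m/pm)^k ≤ exps p (fun x => f (ow I a x)) := by
  classical
  have hm : 1 ≤ m := Nat.one_le_iff_ne_zero.2 (fun h => by subst h; exact z.elim0)
  have hM1 : (1:ℝ) ≤ m/pm := by
    rw [le_div_iff₀ hpm0]
    have : (1:ℝ) ≤ m := by exact_mod_cast hm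
    linarith
  set W : (Fin n → Fin m) → ℝ := fun s =>
    ∏ i, (if i ∈ I then φ (s i) (a i) else if s i = z then 1 else 0) with hW
  have p1 : ∑ x, p x = 1 := by
    have := hF.mean z; simpa [hF.one] using this
  have e1 : exps p (fun x => f (ow I a x)) = ∑ s, hat p φ f s * W s := by
    have : ∀ x, f (ow I a x) = ∑ s, hat p φ f s * ph φ s (ow I a x) := fun x => hF.inversion f _
    simp only [this, exps_sum, exps_mul_left]
    refine Finset.sum_congr rfl fun s _ => ?_
    congr 1
    have : ∀ x, ph φ s (ow I a x) = ∏ i, (fun i y => if i ∈ I then φ (s i) (a i) else φ (s i) y) i (x i) := by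
      intro x; unfold ph ow
      refine Finset.prod_congr rfl fun i _ => ?_
      simp only
      split_ifs <;> rfl
    simp only [this]
    rw [exps_prod p (fun i y => if i ∈ I then φ (s i) (a i) else φ (s i) y)]
    refine Finset.prod_congr rfl fun i _ => ?_
    by_cases hi : i ∈ I
    · simp only [if_pos hi, ← Finset.sum_mul, p1, one_mul]
    · simp only [if_neg hi, hF.mean]
  have hz : hat p φ f (fun _ => z) * W (fun _ => z) = exps p f := by
    have : W (fun _ => z) = 1 := by
      simp only [hW]
      exact Finset.prod_eq_one fun i _ => by split_ifs <;> simp [hF.one]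
    rw [this, mul_one]
    unfold hat ph
    simp [hF.one]
  rw [e1, ← Finset.add_sum_erase _ _ (Finset.mem_univ (fun _ => z)), hz]
  have hrest : ∀ s ∈ Finset.univ.erase (fun _ : Fin n => z), -(γ * |W s|) ≤ hat p φ f s * W s := by
    intro s hs
    by_cases hW0 : W s = 0
    · rw [hW0]; simp
    have hsub : Finset.univ.filter (fun i => s i ≠ z) ⊆ I := by
      intro i hi
      by_contra hiI
      apply hW0
      refine Finset.prod_eq_zero (Finset.mem_univ i) ?_
      simp only [Finset.mem_filter, Finset.mem_univ, true_and] at hi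
      simp [hiI, hi]
    have hk : dg z s ≤ k := (Finset.card_le_card hsub).trans hI
    have h0 : 0 < dg z s := by
      obtain ⟨i, hi⟩ := Function.ne_iff.1 (Finset.ne_of_mem_erase hs)
      exact Finset.card_pos.2 ⟨i, by simpa using hi⟩
    have := hγ s h0 hk
    have h3 : |hat p φ f s * W s| ≤ γ * |W s| := by
      rw [abs_mul]; exact mul_le_mul_of_nonneg_right this (abs_nonneg _)
    exact (abs_le.1 h3).1
  have hsum : ∑ s, |W s| ≤ (m/pm)^k := by
    have : ∀ s, |W s| = ∏ i, (fun i b => |if i ∈ I then φ b (a i) else if b = z then 1 else 0|) i (s i) := by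
      intro s; simp only [hW]; rw [Finset.abs_prod]
    simp only [this]
    rw [sum_pi_prod (fun i b => |if i ∈ I then φ b (a i) else if b = z then (1:ℝ) else 0|)]
    calc _ ≤ ∏ i, (if i ∈ I then (m/pm : ℝ) else 1) := by
          refine Finset.prod_le_prod (fun i _ => Finset.sum_nonneg fun b _ => abs_nonneg _) fun i _ => ?_
          by_cases hi : i ∈ I
          · simp only [if_pos hi]
            have hb : ∀ b, |φ b (a i)| ≤ 1/pm := by
              intro b
              have c1 := hF.compl1 (a i)
              have c2 : φ b (a i) * φ b (a i) ≤ ∑ b, φ b (a i) * φ b (a i) :=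
                Finset.single_le_sum (f := fun b => φ b (a i) * φ b (a i))
                  (fun b _ => mul_self_nonneg _) (Finset.mem_univ b)
              have c3 : pm * (φ b (a i) * φ b (a i)) ≤ 1 := by
                rw [← c1]
                exact mul_le_mul (hpm _) c2 (mul_self_nonneg _) (hpm0.le.trans (hpm _))
              refine abs_le_of_sq_le_sq ?_ (by positivity)
              rw [div_pow, one_pow, le_div_iff₀ (by positivity)]
              nlinarith [mul_self_nonneg (φ b (a i))]
            calc _ ≤ ∑ b : Fin m, 1/pm := Finset.sum_le_sum fun b _ => hb b
              _ = m/pm := by simp; ring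
          · simp only [if_neg hi]
            refine le_of_eq ?_
            have : ∀ b : Fin m, |if b = z then (1:ℝ) else 0| = if b = z then 1 else 0 := by
              intro b; split_ifs <;> simp
            simp [this]
      _ = (m/pm)^I.card := by
          rw [← Finset.prod_filter, Finset.prod_const]; simp
      _ ≤ _ := pow_le_pow_right₀ hM1 hI
  have h5 : ∑ s ∈ Finset.univ.erase (fun _ : Fin n => z), -(γ * |W s|) ≤
      ∑ s ∈ Finset.univ.erase (fun _ : Fin n => z), hat p φ f s * W s := Finset.sum_le_sum hrest
  rw [Finset.sum_neg_distrib, ← Finset.mul_sum] at h5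
  have h6 : ∑ s ∈ Finset.univ.erase (fun _ : Fin n => z), |W s| ≤ ∑ s, |W s| :=
    Finset.sum_le_sum_of_subset_of_nonneg (Finset.erase_subset _ _) fun _ _ _ => abs_nonneg _
  have h7 := mul_le_mul_of_nonneg_left (h6.trans hsum) hγ0
  linarith

lemma exists_lower {β : Type} [Finite β] (f : β → ℝ) (hf : ∀ b, 0 < f b) :
    ∃ c : ℝ, 0 < c ∧ c ≤ 1 ∧ ∀ b, c ≤ f b := by
  rcases isEmpty_or_nonempty β with h | h
  · exact ⟨1, one_pos, le_rfl, fun b => h.elim b⟩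
  · obtain ⟨b, hb⟩ := Finite.exists_min f
    exact ⟨min (f b) 1, lt_min (hf b) one_pos, min_le_right _ _,
      fun b' => (min_le_left _ _).trans (hb b')⟩

/-- set hitting for functions with no large low-degree Fourier
coefficients. -/
theorem set_hitting_small_fourier_coefficients
    {Ω : Type} [Fintype Ω] {ℓ m : ℕ}
    (hcard : Fintype.card Ω = m) (hm0 : 0 < m)
    (P : (Fin ℓ → Ω) → ℝ) (hP : IsDist P)
    (hsupp : ∀ (j : Fin ℓ) (a : Ω), 0 < marginal P j a)
    (hrho : rho P < 1)
    (μ : Fin ℓ → ℝ) (hμ : ∀ j, μ j ∈ Set.Ioc (0:ℝ) 1) :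
    ∃ k : ℕ, ∃ γ : ℝ, 0 < γ ∧ ∃ δ : ℝ, 0 < δ ∧
      ∀ n : ℕ, 1 ≤ n →
      ∀ φ : Fin ℓ → Fin m → Ω → ℝ,
        (∀ j : Fin ℓ,
          (∀ w : Ω, φ j ⟨0, hm0⟩ w = 1) ∧
          (∀ a b : Fin m,
            expPi (marginal P j) (fun w => φ j a w * φ j b w) =
              if a = b then 1 else 0)) →
      ∀ f : Fin ℓ → ((Fin n → Ω) → ℝ),
        (∀ j v, f j v ∈ Set.Icc (0:ℝ) 1) →
        (∀ j, exps (marginal P j) (f j) = μ j) →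
        (∀ (j : Fin ℓ) (σ : Fin n → Fin m),
          0 < (Finset.univ.filter (fun i => σ i ≠ ⟨0, hm0⟩)).card →
          (Finset.univ.filter (fun i => σ i ≠ ⟨0, hm0⟩)).card ≤ k →
          |exps (marginal P j) (fun v => f j v * ∏ i, φ j (σ i) (v i))| ≤ γ) →
        δ ≤ prodExp P f := by
  classical
  have hne : Nonempty Ω := Fintype.card_pos_iff.1 (by omega)
  obtain ⟨r, hr⟩ : ∃ r : ℝ, r = max (rho P) 0 := ⟨_, rfl⟩
  have hr0 : 0 ≤ r := by rw [hr]; exact le_max_right _ _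
  have hrr : rho P ≤ r := by rw [hr]; exact le_max_left _ _
  have hr1 : r < 1 := by rw [hr]; exact max_lt hrho one_pos
  have hK := Kj_ker hP hsupp hr0 hrr hr1
  obtain ⟨pm, hpm0, hpm1, hpm⟩ := exists_lower (fun x : Fin ℓ × Ω => marginal P x.1 x.2)
    (fun x => hsupp x.1 x.2)
  obtain ⟨pmin, hpmin0, hpmin1, hpmin⟩ := exists_lower
    (fun t : Fin ℓ → Ω => if 0 < P t then P t else 1)
    (fun t => by split_ifs with h; exacts [h, one_pos])
  have hpmin' : ∀ t, 0 < P t → pmin ≤ P t := by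
    intro t ht; have := hpmin t; rwa [if_pos ht] at this
  obtain ⟨α2, hα20, _, hα2⟩ := exists_lower μ (fun j => (hμ j).1)
  obtain ⟨α, hα⟩ : ∃ α : ℝ, α = α2/2 := ⟨_, rfl⟩
  have hα0 : 0 < α := by rw [hα]; positivity
  obtain ⟨δ, hδ, τ, hτ, hout⟩ := outer_induction hP hK hpm0 (fun j a => hpm (j, a))
    (⟨0, hm0⟩ : Fin m) hα0 Finset.univ
  have hr2 : 0 < 1 - r^2 := by nlinarith
  have hcc : 0 < (1-r^2)*τ := mul_pos hr2 hτ
  obtain ⟨N, hN⟩ := exists_nat_gt ((ℓ:ℝ) / ((1-r^2)*τ))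
  rw [div_lt_iff₀ hcc] at hN
  have hM0 : (0:ℝ) < m/pm := div_pos (by exact_mod_cast hm0) hpm0
  refine ⟨N, α / ((m/pm)^N), by positivity, pmin^N * δ, by positivity, ?_⟩
  intro n _ φ hφ f hf hfμ hfγ
  have hFB : ∀ j, FB (marginal P j) (φ j) ⟨0, hm0⟩ := fun j =>
    FB_of_basis hcard (hsupp j) (φ j) ⟨0, hm0⟩ (hφ j).1 (hφ j).2
  obtain ⟨g, hg, ⟨I, hI, a, ha⟩, hinf, hpr⟩ := removal hP hK hpmin0 hpmin1 hpmin' (τ := τ) N f hf (by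
    have : 0 ≤ ∑ j, exps (marginal P j) (f j) := Finset.sum_nonneg fun j _ =>
      exps_nonneg (fun a => (hsupp j a).le) fun v => (hf j v).1
    linarith)
  have hmean : ∀ j, α ≤ exps (marginal P j) (g j) := by
    intro j
    have h1 := restricted_mean (hFB j) hpm0 hpm1 (fun a => hpm (j, a)) (f j)
      (k := N) (γ := α / ((m/pm)^N)) (by positivity) (fun s h1 h2 => hfγ j s h1 h2) I hI (a j)
    rw [div_mul_cancel₀ _ (by positivity), hfμ j] at h1
    have h2 := exps_mono (fun b => (hsupp j b).le) (ha j)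
    have h3 := hα2 j
    linarith
  have hfin := hout n φ hFB g hg hmean hinf
  rw [← prodExp_eq] at hfin
  exact (mul_le_mul_of_nonneg_left hfin (by positivity)).trans hpr

end SameSetHitting
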